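/- arXiv:2204.05026 — 5 statements merged into one kernel-verified Lean document; each statement's English description precedes it below -/
import Mathlib

section
/- Let n be a positive integer divisible by 4 and let Γ = IOCG_n(D,σ) be an integral oriented circulant graph with Hermitian eigenvalues μ_0,…,μ_{n−1}. Then the following are equivalent: (i) for every b ∈ Z_n, Γ has perfect state transfer between the vertices b + n/2 and b; (ii) D₂ = {n/4}, i.e. {d ∈ D : ν₂(n/d) = 2} = {n/4}. -/
open Complex Finset

noncomputable section

/-- `G_n^r(d) = { dk : k ≡ r (mod 4), gcd(dk, n) = d } ⊆ {1, …, n−1}`. -/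
def Gsetr (n r d : ℕ) : Finset ℕ :=
  (Finset.range n).filter (fun a => d ∣ a ∧ (a / d) % 4 = r ∧ Nat.gcd a n = d)

/-- The symbol `C = ⋃_{d ∈ D} S_n(d)` of the integral oriented circulant graph
`IOCG_n(D, σ)`, where `S_n(d) = G_n^1(d)` if `σ d = 1` and `S_n(d) = G_n^3(d)` otherwise. -/
def symbol (n : ℕ) (D : Finset ℕ) (σ : ℕ → ℤ) : Finset ℕ :=
  D.biUnion (fun d => Gsetr n (if σ d = 1 then 1 else 3) d)

/-- The Hermitian adjacency matrix of the oriented circulant graph with symbol `C`. -/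
def hermMatrix (n : ℕ) [NeZero n] (C : Finset ℕ) : Matrix (ZMod n) (ZMod n) ℂ :=
  Matrix.of fun u v =>
    if (v - u).val ∈ C then Complex.I
    else if (u - v).val ∈ C then -Complex.I else 0

/-- The transition matrix `U(t) = exp(i t H)`. -/
def transitionMatrix (n : ℕ) [NeZero n] (C : Finset ℕ) (t : ℝ) :
    Matrix (ZMod n) (ZMod n) ℂ :=
  NormedSpace.exp ((Complex.I * (t : ℂ)) • hermMatrix n C)

/-- Perfect state transfer from `u` to `v`. -/
def hasPST (n : ℕ) [NeZero n] (C : Finset ℕ) (u v : ZMod n) : Prop :=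
  ∃ (t : ℝ) (γ : ℂ), ‖γ‖ = 1 ∧
    (transitionMatrix n C t).mulVec (Pi.single u 1) = γ • (Pi.single v 1 : ZMod n → ℂ)

/-- Multiple state transfer on a vertex set `S`: PST between every pair of
distinct vertices of `S`. -/
def hasMST (n : ℕ) [NeZero n] (C : Finset ℕ) (S : Set (ZMod n)) : Prop :=
  ∀ u ∈ S, ∀ v ∈ S, u ≠ v → hasPST n C u v

/-- The Hermitian eigenvalues `μ_j = i ∑_{k ∈ C} (ω^{jk} − ω^{−jk})`, `ω = exp(2πi/n)`. -/
def eigval (n : ℕ) (C : Finset ℕ) (j : ℕ) : ℂ :=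
  Complex.I * ∑ k ∈ C, (Complex.exp (2 * Real.pi * Complex.I * j * k / n) -
    Complex.exp (-(2 * Real.pi * Complex.I * j * k / n)))

/-- Ramanujan's sum `c_n(q) = ∑_{1 ≤ a ≤ n, gcd(a,n)=1} exp(2πi a q / n)`. -/
def ramanujanSum (n q : ℕ) : ℂ :=
  ∑ a ∈ (Finset.Icc 1 n).filter (fun a => Nat.gcd a n = 1),
    Complex.exp (2 * Real.pi * Complex.I * a * q / n)

/-- Ramanujan's sine sum `s_n(q) = i ∑_{a ∈ G_n^1(1)} (ω^{aq} − ω^{−aq})`. -/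
def sineSum (n q : ℕ) : ℂ :=
  Complex.I * ∑ a ∈ Gsetr n 1 1, (Complex.exp (2 * Real.pi * Complex.I * a * q / n) -
    Complex.exp (-(2 * Real.pi * Complex.I * a * q / n)))

open scoped Matrix in
/-- A left eigenvector of a matrix is a left eigenvector of its exponential. -/
theorem Matrix.vecMul_exp_of_vecMul_eq_smul {m : Type*} [Fintype m] [DecidableEq m]
    (A : Matrix m m ℂ) (w : m → ℂ) (c : ℂ) (h : w ᵥ* A = c • w) :
    w ᵥ* NormedSpace.exp A = Complex.exp c • w := by
  let _ : NormedRing (Matrix m m ℂ) := Matrix.linftyOpNormedRing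
  let _ : NormedAlgebra ℂ (Matrix m m ℂ) := Matrix.linftyOpNormedAlgebra
  have hpow (k : ℕ) : w ᵥ* A ^ k = c ^ k • w := by
    induction k with
    | zero => simp
    | succ k ih => rw [pow_succ, ← Matrix.vecMul_vecMul, ih, Matrix.smul_vecMul, h, smul_smul,
        pow_succ]
  have hA := NormedSpace.exp_series_hasSum_exp' (𝕂 := ℂ) A
  have hc := NormedSpace.exp_series_hasSum_exp' (𝕂 := ℂ) c
  rw [← Complex.exp_eq_exp_ℂ] at hc
  let L : Matrix m m ℂ →ₗ[ℂ] (m → ℂ) :=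
    { toFun := fun B => w ᵥ* B
      map_add' := fun B B' => Matrix.vecMul_add B B' w
      map_smul' := fun r B => Matrix.vecMul_smul w r B }
  have hL := hA.mapL (LinearMap.toContinuousLinearMap L)
  have hterm : (fun k : ℕ => LinearMap.toContinuousLinearMap L (((k.factorial : ℂ)⁻¹) • A ^ k)) =
      fun k : ℕ => (((k.factorial : ℂ)⁻¹) • c ^ k) • w := by
    ext1 k
    change w ᵥ* _ = _
    rw [Matrix.vecMul_smul, hpow, smul_smul, smul_eq_mul]
  rw [hterm] at hL
  exact hL.unique (hc.smul_const w)

/-- The first row of the Hermitian adjacency matrix with symbol `C`. -/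
def hermRow (n : ℕ) [NeZero n] (C : Finset ℕ) (x : ZMod n) : ℂ :=
  if x.val ∈ C then Complex.I else if (-x).val ∈ C then -Complex.I else 0

/-- The eigenvalue of the Hermitian adjacency matrix at the character `x ↦ ω ^ (j * x)`. -/
def charEig (n : ℕ) [NeZero n] (C : Finset ℕ) (j : ZMod n) : ℂ :=
  ∑ x : ZMod n, hermRow n C x * ZMod.stdAddChar (j * x)

open scoped Matrix in
theorem vecMul_hermMatrix (n : ℕ) [NeZero n] (C : Finset ℕ) (j : ZMod n) :
    (fun u : ZMod n => (ZMod.stdAddChar (-(j * u)) : ℂ)) ᵥ* hermMatrix n C =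
      charEig n C j • fun u : ZMod n => (ZMod.stdAddChar (-(j * u)) : ℂ) := by
  ext v
  simp only [Matrix.vecMul, dotProduct, Pi.smul_apply, smul_eq_mul, charEig, sum_mul]
  refine Fintype.sum_equiv (Equiv.subLeft v) _ _ fun u => ?_
  have hrow : hermMatrix n C u v = hermRow n C (v - u) := by simp [hermMatrix, hermRow]
  rw [hrow, Equiv.subLeft_apply, mul_assoc, ← AddChar.map_add_eq_mul, mul_comm]
  congr 2
  ring

open scoped Matrix in
theorem hasPST_iff (n : ℕ) [NeZero n] (C : Finset ℕ) (u v : ZMod n) :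
    hasPST n C u v ↔ ∃ (t : ℝ) (γ : ℂ), ‖γ‖ = 1 ∧ ∀ j : ZMod n,
      Complex.exp (Complex.I * t * charEig n C j) * ZMod.stdAddChar (-(j * u)) =
        γ * ZMod.stdAddChar (-(j * v)) := by
  have hdft (x : ZMod n → ℂ) (j : ZMod n) :
      ZMod.dft x j = (fun u : ZMod n => (ZMod.stdAddChar (-(j * u)) : ℂ)) ⬝ᵥ x := by
    simp [ZMod.dft_apply, dotProduct, mul_comm j]
  refine exists_congr fun t => exists_congr fun γ => and_congr_right fun _ => ?_
  rw [← ZMod.dft.injective.eq_iff, funext_iff]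
  refine forall_congr' fun j => ?_
  have hU : (fun u : ZMod n => (ZMod.stdAddChar (-(j * u)) : ℂ)) ᵥ* transitionMatrix n C t =
      Complex.exp (Complex.I * t * charEig n C j) •
        fun u : ZMod n => (ZMod.stdAddChar (-(j * u)) : ℂ) :=
    Matrix.vecMul_exp_of_vecMul_eq_smul _ _ _ <| by
      rw [Matrix.vecMul_smul, vecMul_hermMatrix, smul_smul]
  rw [hdft, hdft, Matrix.dotProduct_mulVec, hU]
  simp [dotProduct_single]
theorem odd_of_isCoprime_four_mul {k : ℤ} {M : ℕ} (hk : IsCoprime k (4 * M : ℕ)) : Odd k := by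
  obtain ⟨a, b, hab⟩ := hk
  by_contra h
  obtain ⟨c, rfl⟩ := Int.not_odd_iff_even.mp h
  have : 2 * (a * c + b * (2 * M)) = 1 := by rw [← hab]; push_cast; ring
  omega

theorem val_mem_symbol_iff {n : ℕ} [NeZero n] {D : Finset ℕ} (σ : ℕ → ℤ) {d M : ℕ} (hd : d ∈ D)
    (hn : n = d * (4 * M)) {k : ℤ} (hk : IsCoprime k (4 * M : ℕ)) :
    (((d * k : ℤ) : ZMod n)).val ∈ symbol n D σ ↔ k % 4 = if σ d = 1 then 1 else 3 := by
  have hn0 : 0 < d * (4 * M) := hn ▸ Nat.pos_of_ne_zero (NeZero.ne n)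
  have hd0 : 0 < d := Nat.pos_of_mul_pos_right hn0
  have hM0 : 0 < 4 * M := Nat.pos_of_mul_pos_left hn0
  obtain ⟨l, hl⟩ : ∃ l : ℕ, k % (4 * M : ℕ) = l :=
    Int.eq_ofNat_of_zero_le (Int.emod_nonneg _ (by positivity))
  have hval : (((d * k : ℤ) : ZMod n)).val = d * l := by
    refine Int.ofNat_inj.mp ?_
    rw [ZMod.val_intCast, Nat.cast_mul, congrArg Nat.cast hn, Nat.cast_mul d, Int.mul_emod_mul_of_pos _ _ (by exact_mod_cast hd0),
      hl]
  have hl4 : (l : ℤ) % 4 = k % 4 := by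
    rw [← hl]
    exact Int.emod_emod_of_dvd _ ⟨M, by push_cast; ring⟩
  have hll : l < 4 * M := by
    zify
    rw [← hl]
    exact_mod_cast Int.emod_lt_of_pos k (by exact_mod_cast hM0)
  have hcop : Nat.gcd l (4 * M) = 1 := by
    rwa [← Int.gcd_natCast_natCast, ← hl, Int.gcd_emod, ← Int.isCoprime_iff_gcd_eq_one]
  have hgcd : Nat.gcd (d * l) n = d := by rw [hn, Nat.gcd_mul_left, hcop, mul_one]
  have hdiv : d * l / d = l := Nat.mul_div_cancel_left _ hd0
  rw [hval, symbol, mem_biUnion]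
  simp only [Gsetr, mem_filter, mem_range, hgcd]
  constructor
  · rintro ⟨e, _, -, -, h, rfl⟩
    rw [hdiv] at h
    rw [← hl4]
    split_ifs at h ⊢ <;> omega
  · intro h
    refine ⟨d, hd, ?_, dvd_mul_right _ _, ?_, rfl⟩
    · rw [hn]
      exact Nat.mul_lt_mul_of_pos_left hll hd0
    · rw [hdiv]
      rw [← hl4] at h
      split_ifs at h ⊢ <;> omega

theorem hermRow_symbol_mul {n : ℕ} [NeZero n] {D : Finset ℕ} (σ : ℕ → ℤ) {d M : ℕ} (hd : d ∈ D)
    (hn : n = d * (4 * M)) {k : ℤ} (hk : IsCoprime k (4 * M : ℕ)) :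
    hermRow n (symbol n D σ) ((d * k : ℤ) : ZMod n) =
      Complex.I * ((if σ d = 1 then 1 else -1) * ZMod.χ₄ k : ℤ) := by
  have hneg : -((d * k : ℤ) : ZMod n) = ((d * -k : ℤ) : ZMod n) := by push_cast; ring
  have hodd : k % 2 = 1 := Int.odd_iff.mp (odd_of_isCoprime_four_mul hk)
  simp only [hermRow, hneg, val_mem_symbol_iff σ hd hn hk, val_mem_symbol_iff σ hd hn hk.neg_left]
  rcases (by omega : k % 4 = 1 ∨ k % 4 = 3) with h | h
  · have h' : -k % 4 = 3 := by omega
    rw [ZMod.χ₄_int_one_mod_four h, h, h']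
    by_cases hs : σ d = 1 <;> simp [hs]
  · have h' : -k % 4 = 1 := by omega
    rw [ZMod.χ₄_int_three_mod_four h, h, h']
    by_cases hs : σ d = 1 <;> simp [hs]

theorem exists_eq_mul_of_hermRow_symbol_ne_zero {n : ℕ} [NeZero n] {D : Finset ℕ} {σ : ℕ → ℤ}
    (hn4 : 4 ∣ n) (hD : ∀ d ∈ D, d ∣ n / 4) {x : ZMod n} (hx : hermRow n (symbol n D σ) x ≠ 0) :
    ∃ d ∈ D, ∃ M : ℕ, n = d * (4 * M) ∧
      ∃ k : ℤ, IsCoprime k (4 * M : ℕ) ∧ x = ((d * k : ℤ) : ZMod n) := by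
  have key (y : ZMod n) (hy : y.val ∈ symbol n D σ) : ∃ d ∈ D, ∃ M : ℕ, n = d * (4 * M) ∧
      ∃ k : ℤ, IsCoprime k (4 * M : ℕ) ∧ y = ((d * k : ℤ) : ZMod n) := by
    rw [symbol, mem_biUnion] at hy
    obtain ⟨d, hd, hy⟩ := hy
    simp only [Gsetr, mem_filter, mem_range] at hy
    obtain ⟨-, ⟨k, hk⟩, -, hg⟩ := hy
    obtain ⟨M, hM⟩ := hD d hd
    have hn : n = d * (4 * M) := by
      rw [← Nat.div_mul_cancel hn4, hM]; ring
    have hd0 : 0 < d := Nat.pos_of_ne_zero fun h => NeZero.ne n (by rw [hn, h, zero_mul])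
    refine ⟨d, hd, M, hn, k, ?_, ?_⟩
    · rw [Nat.isCoprime_iff_coprime]
      rw [hk, hn, Nat.gcd_mul_left] at hg
      exact Nat.eq_of_mul_eq_mul_left hd0 (hg.trans (mul_one d).symm)
    · rw [← ZMod.natCast_zmod_val y, hk]
      push_cast
      rfl
  rw [hermRow] at hx
  split_ifs at hx with h1 h2
  · exact key x h1
  · obtain ⟨d, hd, M, hn, k, hk, hx⟩ := key _ h2
    exact ⟨d, hd, M, hn, -k, hk.neg_left, by rw [← neg_neg x, hx]; push_cast; ring⟩
  · exact absurd rfl hx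
theorem half_add_half {n : ℕ} (h2 : 2 ∣ n) : ((n / 2 : ℕ) : ZMod n) + ((n / 2 : ℕ) : ZMod n) = 0 := by
  rw [← Nat.cast_add, ← two_mul, Nat.mul_div_cancel' h2, ZMod.natCast_self]

theorem hermRow_symbol_mul_add_half {n : ℕ} [NeZero n] {D : Finset ℕ} (σ : ℕ → ℤ) {d M : ℕ}
    (hd : d ∈ D) (hn : n = d * (4 * M)) {k : ℤ} (hk : IsCoprime k (4 * M : ℕ)) :
    hermRow n (symbol n D σ) (((d * k : ℤ) : ZMod n) + (n / 2 : ℕ)) =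
      (-1) ^ M * hermRow n (symbol n D σ) ((d * k : ℤ) : ZMod n) := by
  have hadd : ((d * k : ℤ) : ZMod n) + (n / 2 : ℕ) = ((d * (k + 2 * M) : ℤ) : ZMod n) := by
    have : n / 2 = d * (2 * M) := by
      rw [hn]
      exact Nat.div_eq_of_eq_mul_left two_pos (by ring)
    rw [this]
    push_cast
    ring
  have hodd : k % 2 = 1 := Int.odd_iff.mp (odd_of_isCoprime_four_mul hk)
  have hk2 : IsCoprime (k + 2 * M) (4 * M : ℕ) := by
    have h4 : IsCoprime (k + 2 * M) (4 : ℤ) := by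
      rw [show (4 : ℤ) = 2 ^ 2 by norm_num]
      refine IsCoprime.pow_right ?_
      rw [Int.isCoprime_iff_gcd_eq_one, ← Int.gcd_emod, show (k + 2 * M) % 2 = 1 by omega]
      rfl
    have hM : IsCoprime (k + 2 * M) (M : ℤ) := by
      have : IsCoprime k (M : ℤ) := IsCoprime.of_isCoprime_of_dvd_right hk ⟨4, by push_cast; ring⟩
      exact this.add_mul_right_left 2
    have := h4.mul_right hM
    exact_mod_cast this
  rw [hadd, hermRow_symbol_mul σ hd hn hk2, hermRow_symbol_mul σ hd hn hk]
  have hχ : ZMod.χ₄ ((k + 2 * M : ℤ) : ZMod 4) = (-1) ^ M * ZMod.χ₄ (k : ZMod 4) := by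
    rw [ZMod.χ₄_int_eq_if_mod_four, ZMod.χ₄_int_eq_if_mod_four]
    rcases Nat.even_or_odd' M with ⟨c, rfl | rfl⟩
    · rw [pow_mul]
      push_cast
      rw [show (k + 2 * (2 * c)) % 2 = k % 2 by omega, show (k + 2 * (2 * c)) % 4 = k % 4 by omega]
      simp
    · rw [pow_succ, pow_mul]
      push_cast
      rw [show (k + 2 * (2 * c + 1)) % 2 = k % 2 by omega,
        show (k + 2 * (2 * c + 1)) % 4 = (k + 2) % 4 by omega]
      rcases (by omega : k % 4 = 1 ∨ k % 4 = 3) with h | h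
      · rw [hodd, show (k + 2) % 4 = 3 by omega, h]
        norm_num
      · rw [hodd, show (k + 2) % 4 = 1 by omega, h]
        norm_num
  rw [hχ]
  push_cast
  ring

theorem hermRow_symbol_add_half_of_odd {n a N : ℕ} [NeZero n] {D : Finset ℕ} {σ : ℕ → ℤ}
    (hn : n = 2 ^ a * (4 * N)) (hN : Odd N) (hD : ∀ d ∈ D, d ∣ n / 4) {y : ℤ} (hy : Odd y) :
    hermRow n (symbol n D σ) (((2 ^ a * y : ℤ) : ZMod n) + (n / 2 : ℕ)) =
      -hermRow n (symbol n D σ) ((2 ^ a * y : ℤ) : ZMod n) := by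
  have hn4 : 4 ∣ n := ⟨2 ^ a * N, by rw [hn]; ring⟩
  have main {y : ℤ} (hy : Odd y)
      (h0 : hermRow n (symbol n D σ) ((2 ^ a * y : ℤ) : ZMod n) ≠ 0) :
      hermRow n (symbol n D σ) (((2 ^ a * y : ℤ) : ZMod n) + (n / 2 : ℕ)) =
        -hermRow n (symbol n D σ) ((2 ^ a * y : ℤ) : ZMod n) := by
    obtain ⟨d, hd, M, hdM, k, hk, hx⟩ := exists_eq_mul_of_hermRow_symbol_ne_zero hn4 hD h0
    rw [hx, hermRow_symbol_mul_add_half σ hd hdM hk]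
    suffices hM : Odd M by rw [hM.neg_one_pow, neg_one_mul]
    rw [ZMod.intCast_eq_intCast_iff_dvd_sub] at hx
    obtain ⟨t, ht⟩ := hx
    have hdM' : d * M = 2 ^ a * N := by
      have := hdM.symm.trans hn
      nlinarith
    have hk2 : IsCoprime (2 ^ a : ℤ) k := by
      refine IsCoprime.pow_left ?_
      exact (IsCoprime.of_isCoprime_of_dvd_right hk ⟨2 * M, by push_cast; ring⟩).symm
    have h2d : (2 ^ a : ℤ) ∣ d * k := by
      refine ⟨y + 4 * N * t, ?_⟩
      rw [congrArg Nat.cast hn] at ht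
      push_cast at ht
      linear_combination ht
    obtain ⟨e, rfl⟩ : 2 ^ a ∣ d := by exact_mod_cast hk2.dvd_of_dvd_mul_right h2d
    rw [mul_assoc] at hdM'
    have := Nat.eq_of_mul_eq_mul_left (by positivity) hdM'
    rw [← this] at hN
    exact Nat.Odd.of_mul_right hN
  by_cases h0 : hermRow n (symbol n D σ) ((2 ^ a * y : ℤ) : ZMod n) = 0
  · by_contra hne
    rw [h0, neg_zero] at hne
    have hadd : ((2 ^ a * y : ℤ) : ZMod n) + (n / 2 : ℕ) =
        ((2 ^ a * (y + 2 * N) : ℤ) : ZMod n) := by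
      rw [show n / 2 = 2 ^ a * (2 * N) by
        rw [hn]
        exact Nat.div_eq_of_eq_mul_left two_pos (by ring)]
      push_cast
      ring
    have := main (hy.add_even ⟨(N : ℤ), two_mul _⟩) (hadd ▸ hne)
    rw [← hadd, add_assoc, half_add_half (dvd_trans (by norm_num) hn4), add_zero, h0,
      eq_comm, neg_eq_zero] at this
    exact hne this
  · exact main hy h0

theorem exists_odd_of_hermRow_symbol_add_half_ne {n a N : ℕ} [NeZero n] {D : Finset ℕ} {σ : ℕ → ℤ}
    (hn : n = 2 ^ a * (4 * N)) (hN : Odd N) (hD : ∀ d ∈ D, d ∣ n / 4) {x : ZMod n}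
    (hx : hermRow n (symbol n D σ) (x + (n / 2 : ℕ)) ≠ hermRow n (symbol n D σ) x) :
    ∃ y : ℤ, Odd y ∧ x = ((2 ^ a * y : ℤ) : ZMod n) := by
  have hn4 : 4 ∣ n := ⟨2 ^ a * N, by rw [hn]; ring⟩
  have main {x : ZMod n} (h0 : hermRow n (symbol n D σ) x ≠ 0)
      (hx : hermRow n (symbol n D σ) (x + (n / 2 : ℕ)) ≠ hermRow n (symbol n D σ) x) :
      ∃ y : ℤ, Odd y ∧ x = ((2 ^ a * y : ℤ) : ZMod n) := by
    obtain ⟨d, hd, M, hdM, k, hk, rfl⟩ := exists_eq_mul_of_hermRow_symbol_ne_zero hn4 hD h0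
    rw [hermRow_symbol_mul_add_half σ hd hdM hk] at hx
    have hM : Odd M := by
      rw [← Nat.not_even_iff_odd]
      exact fun hM => hx (by rw [hM.neg_one_pow, one_mul])
    have hdM' : d * M = 2 ^ a * N := by
      have := hdM.symm.trans hn
      nlinarith
    have hc : Nat.Coprime (2 ^ a) M := Nat.Coprime.pow_left _ (Nat.coprime_two_left.mpr hM)
    obtain ⟨e, rfl⟩ : 2 ^ a ∣ d := hc.dvd_of_dvd_mul_right ⟨N, hdM'⟩
    rw [mul_assoc] at hdM'
    have heM := Nat.eq_of_mul_eq_mul_left (by positivity) hdM'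
    rw [← heM] at hN
    refine ⟨e * k, ?_, by push_cast; ring⟩
    exact ((Int.odd_coe_nat e).mpr (Nat.Odd.of_mul_left hN)).mul (odd_of_isCoprime_four_mul hk)
  by_cases h0 : hermRow n (symbol n D σ) x = 0
  · have hback : x + (n / 2 : ℕ) + (n / 2 : ℕ) = x := by
      rw [add_assoc, half_add_half (dvd_trans (by norm_num) hn4), add_zero]
    obtain ⟨y, hy, hxy⟩ := main (x := x + (n / 2 : ℕ)) (h0 ▸ hx) (by rw [hback]; exact hx.symm)
    refine ⟨y + 2 * N, hy.add_even ⟨(N : ℤ), two_mul _⟩, ?_⟩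
    rw [← hback, hxy, show n / 2 = 2 ^ a * (2 * N) by
      rw [hn]
      exact Nat.div_eq_of_eq_mul_left two_pos (by ring)]
    push_cast
    ring
  · exact main h0 hx
theorem ZMod.sum_eq_sum_range {α : Type*} [AddCommMonoid α] (n : ℕ) [NeZero n] (g : ZMod n → α) :
    ∑ x : ZMod n, g x = ∑ a ∈ range n, g (a : ZMod n) := by
  refine Finset.sum_bij' (fun x _ => x.val) (fun a _ => (a : ZMod n)) ?_ ?_ ?_ ?_ ?_
  · exact fun x _ => mem_range.mpr (ZMod.val_lt x)
  · exact fun a _ => mem_univ _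
  · exact fun x _ => ZMod.natCast_zmod_val x
  · exact fun a ha => ZMod.val_cast_of_lt (mem_range.mp ha)
  · exact fun x _ => by rw [ZMod.natCast_zmod_val]

theorem ZMod.stdAddChar_intCast_eq_one_iff {n : ℕ} [NeZero n] (z : ℤ) :
    (ZMod.stdAddChar (z : ZMod n) : ℂ) = 1 ↔ (n : ℤ) ∣ z := by
  rw [← ZMod.intCast_zmod_eq_zero_iff_dvd, ← ZMod.injective_stdAddChar.eq_iff,
    AddChar.map_zero_eq_one]

theorem ZMod.isIntegral_stdAddChar {n : ℕ} [NeZero n] (x : ZMod n) :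
    IsIntegral ℤ (ZMod.stdAddChar x : ℂ) := by
  refine IsIntegral.of_pow (Nat.pos_of_ne_zero (NeZero.ne n)) ?_
  rw [← AddChar.map_nsmul_eq_pow, nsmul_eq_mul, ZMod.natCast_self, zero_mul,
    AddChar.map_zero_eq_one]
  exact isIntegral_one

theorem ZMod.stdAddChar_half {n : ℕ} [NeZero n] (h2 : 2 ∣ n) :
    (ZMod.stdAddChar ((n / 2 : ℕ) : ZMod n) : ℂ) = -1 := by
  have hn : 0 < n := Nat.pos_of_ne_zero (NeZero.ne n)
  have hsq : (ZMod.stdAddChar ((n / 2 : ℕ) : ZMod n) : ℂ) ^ 2 = 1 := by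
    rw [← AddChar.map_nsmul_eq_pow, two_nsmul, half_add_half h2, AddChar.map_zero_eq_one]
  refine (sq_eq_one_iff.mp hsq).resolve_left fun h => ?_
  have h' := (ZMod.stdAddChar_intCast_eq_one_iff (n := n) (n / 2 : ℕ)).mp (by exact_mod_cast h)
  have := Nat.le_of_dvd (by omega) (Int.natCast_dvd_natCast.mp h')
  omega

theorem ZMod.stdAddChar_odd_mul_half {n : ℕ} [NeZero n] (h2 : 2 ∣ n) {j : ℤ} (hj : Odd j) :
    (ZMod.stdAddChar ((j : ZMod n) * ((n / 2 : ℕ) : ZMod n)) : ℂ) = -1 := by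
  rw [← zsmul_eq_mul, AddChar.map_zsmul_eq_zpow, ZMod.stdAddChar_half h2, hj.neg_one_zpow]

theorem geom_sum_eq_zero {ζ : ℂ} {N : ℕ} (h : ζ ^ N = 1) (h1 : ζ ≠ 1) :
    ∑ l ∈ range N, ζ ^ l = 0 := by
  rw [geom_sum_eq h1, h, sub_self, zero_div]

theorem not_isIntegral_half_of_odd {k : ℤ} (hk : Odd k) : ¬ IsIntegral ℤ ((k : ℂ) / 2) := by
  intro h
  have h' : IsIntegral ℤ (algebraMap ℚ ℂ ((k : ℚ) / 2)) := by simpa using h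
  rw [isIntegral_algebraMap_iff (algebraMap ℚ ℂ).injective] at h'
  obtain ⟨m, hm⟩ := IsIntegrallyClosed.isIntegral_iff.mp h'
  have : (k : ℚ) = m * 2 := by
    rw [eq_intCast] at hm
    rw [hm]; ring
  have : k = m * 2 := by exact_mod_cast this
  rw [this] at hk
  exact (Int.not_odd_iff_even.mpr (even_two.mul_left m)) hk

/-- The part of the row that changes sign under translation by `n / 2`. -/
def antiRow (n : ℕ) [NeZero n] (C : Finset ℕ) (x : ZMod n) : ℂ :=
  (hermRow n C x - hermRow n C (x + (n / 2 : ℕ))) / 2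

theorem charEig_odd {n : ℕ} [NeZero n] (h2 : 2 ∣ n) (C : Finset ℕ) {j : ℤ} (hj : Odd j) :
    charEig n C (j : ZMod n) = ∑ x : ZMod n, antiRow n C x * ZMod.stdAddChar ((j : ZMod n) * x) := by
  have hshift : charEig n C (j : ZMod n) =
      ∑ x : ZMod n, -(hermRow n C (x + (n / 2 : ℕ)) * ZMod.stdAddChar ((j : ZMod n) * x)) := by
    rw [charEig, ← Equiv.sum_comp (Equiv.addRight ((n / 2 : ℕ) : ZMod n))]
    refine sum_congr rfl fun x _ => ?_
    rw [Equiv.coe_addRight, mul_add, AddChar.map_add_eq_mul, ZMod.stdAddChar_odd_mul_half h2 hj]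
    ring
  rw [show charEig n C (j : ZMod n) = (charEig n C j + charEig n C j) / 2 by ring]
  nth_rewrite 2 [hshift]
  rw [charEig, ← sum_add_distrib, sum_div]
  refine sum_congr rfl fun x _ => ?_
  rw [antiRow]
  ring

theorem antiRow_add_half {n : ℕ} [NeZero n] (h2 : 2 ∣ n) (C : Finset ℕ) (x : ZMod n) :
    antiRow n C (x + (n / 2 : ℕ)) = -antiRow n C x := by
  rw [antiRow, antiRow, add_assoc, half_add_half h2, add_zero]
  ring

theorem isIntegral_hermRow (n : ℕ) [NeZero n] (C : Finset ℕ) (x : ZMod n) :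
    IsIntegral ℤ (hermRow n C x) := by
  rw [hermRow]
  split_ifs
  exacts [isIntegral_int_I, isIntegral_int_I.neg, isIntegral_zero]

theorem antiRow_symbol_of_odd {n a N : ℕ} [NeZero n] {D : Finset ℕ} {σ : ℕ → ℤ}
    (hn : n = 2 ^ a * (4 * N)) (hN : Odd N) (hD : ∀ d ∈ D, d ∣ n / 4) {y : ℤ} (hy : Odd y) :
    antiRow n (symbol n D σ) ((2 ^ a * y : ℤ) : ZMod n) =
      hermRow n (symbol n D σ) ((2 ^ a * y : ℤ) : ZMod n) := by
  rw [antiRow, hermRow_symbol_add_half_of_odd hn hN hD hy]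
  ring

theorem antiRow_symbol_eq_zero_or {n a N : ℕ} [NeZero n] {D : Finset ℕ} {σ : ℕ → ℤ}
    (hn : n = 2 ^ a * (4 * N)) (hN : Odd N) (hD : ∀ d ∈ D, d ∣ n / 4) (x : ZMod n) :
    antiRow n (symbol n D σ) x = 0 ∨ ∃ y : ℤ, Odd y ∧ x = ((2 ^ a * y : ℤ) : ZMod n) := by
  refine or_iff_not_imp_left.mpr fun h =>
    exists_odd_of_hermRow_symbol_add_half_ne hn hN hD (σ := σ) fun h' => h ?_
  rw [antiRow, h', sub_self, zero_div]

theorem isIntegral_antiRow_symbol {n a N : ℕ} [NeZero n] {D : Finset ℕ} {σ : ℕ → ℤ}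
    (hn : n = 2 ^ a * (4 * N)) (hN : Odd N) (hD : ∀ d ∈ D, d ∣ n / 4) (x : ZMod n) :
    IsIntegral ℤ (antiRow n (symbol n D σ) x) := by
  rcases antiRow_symbol_eq_zero_or hn hN hD (σ := σ) x with h | ⟨y, hy, rfl⟩
  · rw [h]
    exact isIntegral_zero
  · rw [antiRow_symbol_of_odd hn hN hD hy]
    exact isIntegral_hermRow _ _ _

/-- The eigenvalue at `1` is twice an algebraic integer. -/
theorem isIntegral_charEig_one_div_two {n a N : ℕ} [NeZero n] {D : Finset ℕ} {σ : ℕ → ℤ}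
    (hn : n = 2 ^ a * (4 * N)) (hN : Odd N) (hD : ∀ d ∈ D, d ∣ n / 4) :
    IsIntegral ℤ (charEig n (symbol n D σ) 1 / 2) := by
  have h2 : 2 ∣ n := ⟨2 ^ a * (2 * N), by rw [hn]; ring⟩
  have h := charEig_odd h2 (symbol n D σ) odd_one
  rw [Int.cast_one] at h
  simp only [one_mul] at h
  rw [h, ZMod.sum_eq_sum_range, show range n = range (n / 2 + n / 2) by congr 1; omega,
    sum_range_add, ← sum_add_distrib, sum_div]
  refine IsIntegral.sum _ fun b _ => ?_
  have : antiRow n (symbol n D σ) ((n / 2 + b : ℕ) : ZMod n) *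
      ZMod.stdAddChar ((n / 2 + b : ℕ) : ZMod n) =
      antiRow n (symbol n D σ) (b : ZMod n) * ZMod.stdAddChar (b : ZMod n) := by
    rw [Nat.cast_add, add_comm, antiRow_add_half h2, AddChar.map_add_eq_mul,
      ZMod.stdAddChar_half h2]
    ring
  rw [this, add_self_div_two]
  exact (isIntegral_antiRow_symbol hn hN hD _).mul (ZMod.isIntegral_stdAddChar _)

theorem sum_charEig_mul_stdAddChar {n a N : ℕ} [NeZero n] {D : Finset ℕ} {σ : ℕ → ℤ}
    (hn : n = 2 ^ a * (4 * N)) (hN : Odd N) (hD : ∀ d ∈ D, d ∣ n / 4) {y : ℤ} (hy : Odd y) :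
    ∑ l ∈ range N, charEig n (symbol n D σ) ((1 + 4 * l : ℤ) : ZMod n) *
        ZMod.stdAddChar (-(((1 + 4 * l : ℤ) : ZMod n) * ((2 ^ a * y : ℤ) : ZMod n))) =
      2 * N * hermRow n (symbol n D σ) ((2 ^ a * y : ℤ) : ZMod n) := by
  have h2 : 2 ∣ n := ⟨2 ^ a * (2 * N), by rw [hn]; ring⟩
  have hn0 : 0 < n := Nat.pos_of_ne_zero (NeZero.ne n)
  set x : ZMod n := ((2 ^ a * y : ℤ) : ZMod n) with hx
  have hswap : ∑ l ∈ range N, charEig n (symbol n D σ) ((1 + 4 * l : ℤ) : ZMod n) *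
        (ZMod.stdAddChar (-(((1 + 4 * l : ℤ) : ZMod n) * x)) : ℂ) =
      ∑ z : ZMod n, antiRow n (symbol n D σ) z * ∑ l ∈ range N,
        (ZMod.stdAddChar (z - x) : ℂ) * ZMod.stdAddChar (4 * (z - x)) ^ l := by
    simp_rw [mul_sum]
    rw [sum_comm]
    refine sum_congr rfl fun l _ => ?_
    rw [charEig_odd h2 _ ⟨2 * (l : ℤ), by ring⟩, sum_mul]
    refine sum_congr rfl fun z _ => ?_
    rw [mul_assoc, ← AddChar.map_add_eq_mul, ← AddChar.map_nsmul_eq_pow, ← AddChar.map_add_eq_mul]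
    congr 2
    push_cast
    rw [nsmul_eq_mul]
    ring
  have hne : x ≠ x + (n / 2 : ℕ) := by
    intro h
    have h0 : ((n / 2 : ℕ) : ZMod n) = 0 := left_eq_add.mp h
    have := Nat.le_of_dvd (by omega) ((ZMod.natCast_eq_zero_iff _ _).mp h0)
    omega
  rw [hswap, Fintype.sum_eq_add x (x + (n / 2 : ℕ)) hne]
  · have h4 : (4 : ZMod n) * (n / 2 : ℕ) = 0 := by
      rw [show (4 : ZMod n) = 2 * 2 by norm_num, mul_assoc, two_mul ((n / 2 : ℕ) : ZMod n),
        half_add_half h2, mul_zero]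
    rw [sub_self, add_sub_cancel_left, antiRow_add_half h2, h4, mul_zero, AddChar.map_zero_eq_one,
      ZMod.stdAddChar_half h2, antiRow_symbol_of_odd hn hN hD hy, ← hx]
    simp only [one_pow, mul_one, sum_const, card_range, nsmul_eq_mul]
    ring
  · rintro z ⟨hzx, hzx'⟩
    rcases antiRow_symbol_eq_zero_or hn hN hD (σ := σ) z with h | ⟨w, hw, rfl⟩
    · rw [h, zero_mul]
    obtain ⟨v, hv⟩ : Even (w - y) := hw.sub_odd hy
    have hsub : ((2 ^ a * w : ℤ) : ZMod n) - x = ((2 ^ a * (2 * v) : ℤ) : ZMod n) := by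
      rw [hx, ← Int.cast_sub]
      congr 1
      rw [← mul_sub, hv]
      ring
    have h4 : (4 : ZMod n) * ((2 ^ a * (2 * v) : ℤ) : ZMod n) =
        ((4 * (2 ^ a * (2 * v)) : ℤ) : ZMod n) := by push_cast; ring
    rw [hsub, ← mul_sum, geom_sum_eq_zero, mul_zero, mul_zero]
    · rw [← AddChar.map_nsmul_eq_pow, nsmul_eq_mul, h4]
      rw [show (N : ZMod n) * ((4 * (2 ^ a * (2 * v)) : ℤ) : ZMod n) =
        ((2 ^ a * (4 * N) : ℕ) : ZMod n) * (2 * v : ℤ) by push_cast; ring, ← hn,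
        ZMod.natCast_self, zero_mul, AddChar.map_zero_eq_one]
    · intro h1
      rw [h4, ZMod.stdAddChar_intCast_eq_one_iff] at h1
      obtain ⟨c, hc⟩ := h1
      have hNv : (2 : ℤ) * v = N * c := by
        rw [congrArg Nat.cast hn] at hc
        push_cast at hc
        have : (2 ^ a * 4 : ℤ) ≠ 0 := by positivity
        refine mul_left_cancel₀ this ?_
        linear_combination hc
      obtain ⟨b, rfl⟩ : (N : ℤ) ∣ v := by
        have hc : IsCoprime (N : ℤ) 2 := by
          exact_mod_cast Nat.isCoprime_iff_coprime.mpr (Nat.coprime_two_right.mpr hN)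
        exact hc.dvd_of_dvd_mul_left ⟨c, hNv⟩
      have hz : ((2 ^ a * w : ℤ) : ZMod n) = x + b * (n / 2 : ℕ) := by
        rw [← sub_eq_iff_eq_add', hsub, show n / 2 = 2 ^ a * (2 * N) by
          rw [hn]
          exact Nat.div_eq_of_eq_mul_left two_pos (by ring)]
        push_cast
        ring
      rcases Int.even_or_odd' b with ⟨e, rfl | rfl⟩
      · refine hzx (hz.trans ?_)
        push_cast
        linear_combination (e : ZMod n) * half_add_half h2
      · refine hzx' (hz.trans ?_)
        push_cast
        linear_combination (e : ZMod n) * half_add_half h2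
theorem hermRow_sq_eq_neg_one (n : ℕ) [NeZero n] (C : Finset ℕ) {x : ZMod n}
    (hx : hermRow n C x ≠ 0) : hermRow n C x ^ 2 = -1 := by
  rw [hermRow] at hx ⊢
  split_ifs at hx ⊢ <;> simp_all

theorem padicValNat_two_eq_two_iff {M : ℕ} (hM : M ≠ 0) : padicValNat 2 (4 * M) = 2 ↔ Odd M := by
  rw [show 4 * M = 2 ^ 2 * M by ring, padicValNat.mul (by norm_num) hM, padicValNat.prime_pow,
    Nat.add_eq_left, padicValNat.eq_zero_iff, ← Nat.not_even_iff_odd, even_iff_two_dvd]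
  simp [hM]

theorem exists_odd_mul_eq_mul_odd {t : ℝ} {μ : ℤ → ℂ}
    (h : ∀ j : ℤ, Odd j → Complex.exp (Complex.I * t * μ j) = -1) :
    ∃ (o : ℤ) (p : ℤ → ℤ), Odd o ∧ ∀ j, Odd j → μ j * o = μ 1 * (1 + 2 * p j) := by
  have hlog (j : ℤ) (hj : Odd j) : ∃ p : ℤ, t * μ j = (1 + 2 * p) * Real.pi := by
    have := h j hj
    rw [← Complex.exp_pi_mul_I, Complex.exp_eq_exp_iff_exists_int] at this
    obtain ⟨p, hp⟩ := this
    refine ⟨p, mul_left_cancel₀ Complex.I_ne_zero ?_⟩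
    linear_combination hp
  choose! p hp using hlog
  have hodd (m : ℤ) : (1 + 2 * m : ℂ) ≠ 0 := by
    have : (1 + 2 * m : ℤ) ≠ 0 := by omega
    exact_mod_cast this
  have hπ : (Real.pi : ℂ) ≠ 0 := by exact_mod_cast Real.pi_ne_zero
  have ht : (t : ℂ) ≠ 0 := fun h0 => by
    have := hp 1 odd_one
    rw [h0, zero_mul] at this
    exact mul_ne_zero (hodd _) hπ this.symm
  refine ⟨1 + 2 * p 1, p, ⟨p 1, by ring⟩, fun j hj => mul_left_cancel₀ ht ?_⟩
  push_cast
  linear_combination (1 + 2 * (p 1 : ℂ)) * hp j hj - (1 + 2 * (p j : ℂ)) * hp 1 odd_one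

theorem filter_eq_of_exp_charEig {n : ℕ} [NeZero n] (hn4 : 4 ∣ n) {D : Finset ℕ} {σ : ℕ → ℤ}
    (hD : ∀ d ∈ D, d ∣ n / 4) {t : ℝ}
    (h : ∀ j : ℤ, Odd j →
      Complex.exp (Complex.I * t * charEig n (symbol n D σ) (j : ZMod n)) = -1) :
    D.filter (fun d => padicValNat 2 (n / d) = 2) = {n / 4} := by
  have hn0 : n ≠ 0 := NeZero.ne n
  obtain ⟨a, N, hN, haN⟩ := Nat.exists_eq_two_pow_mul_odd (n := n / 4) (by omega)
  have hn : n = 2 ^ a * (4 * N) := by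
    rw [← Nat.div_mul_cancel hn4, haN]; ring
  have h2 : 2 ∣ n := dvd_trans (by norm_num) hn4
  obtain ⟨o, p, ho, hop⟩ := exists_odd_mul_eq_mul_odd
    (μ := fun j => charEig n (symbol n D σ) (j : ZMod n)) h
  simp only [Int.cast_one] at hop
  have hvanish {y : ℤ} (hy : Odd y) (hNy : ¬ (N : ℤ) ∣ y) :
      hermRow n (symbol n D σ) ((2 ^ a * y : ℤ) : ZMod n) = 0 := by
    by_contra h0
    set x : ZMod n := ((2 ^ a * y : ℤ) : ZMod n) with hx
    have hgeom : ∑ l ∈ range N, (ZMod.stdAddChar (-(((1 + 4 * l : ℤ) : ZMod n) * x)) : ℂ) = 0 := by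
      have hterm (l : ℕ) : (ZMod.stdAddChar (-(((1 + 4 * l : ℤ) : ZMod n) * x)) : ℂ) =
          ZMod.stdAddChar (-x) * ZMod.stdAddChar (((-(4 * (2 ^ a * y)) : ℤ) : ZMod n)) ^ l := by
        rw [← AddChar.map_nsmul_eq_pow, ← AddChar.map_add_eq_mul, hx, nsmul_eq_mul]
        congr 1
        push_cast
        ring
      simp_rw [hterm]
      rw [← mul_sum, geom_sum_eq_zero, mul_zero]
      · rw [← AddChar.map_nsmul_eq_pow, nsmul_eq_mul,
          show (N : ZMod n) * ((-(4 * (2 ^ a * y)) : ℤ) : ZMod n) =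
            ((2 ^ a * (4 * N) : ℕ) : ZMod n) * (-y : ℤ) by push_cast; ring, ← hn,
          ZMod.natCast_self, zero_mul, AddChar.map_zero_eq_one]
      · intro h1
        rw [ZMod.stdAddChar_intCast_eq_one_iff] at h1
        obtain ⟨c, hc⟩ := h1
        refine hNy ⟨-c, ?_⟩
        rw [congrArg Nat.cast hn] at hc
        push_cast at hc
        have : (2 ^ a * 4 : ℤ) ≠ 0 := by positivity
        refine mul_left_cancel₀ this ?_
        linear_combination -hc
    have hsum := sum_charEig_mul_stdAddChar hn hN hD (σ := σ) hy
    rw [← hx] at hsum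
    set β : ℂ := ∑ l ∈ range N, (p (1 + 4 * l) : ℂ) *
      ZMod.stdAddChar (-(((1 + 4 * l : ℤ) : ZMod n) * x)) with hβ
    have hkey : 2 * N * hermRow n (symbol n D σ) x * o =
        charEig n (symbol n D σ) 1 * (2 * β) := by
      rw [← hsum, sum_mul, ← zero_add (2 * β), ← hgeom, hβ, mul_sum, ← sum_add_distrib, mul_sum]
      refine sum_congr rfl fun l _ => ?_
      linear_combination (ZMod.stdAddChar (-(((1 + 4 * l : ℤ) : ZMod n) * x)) : ℂ) *
        hop (1 + 4 * l) ⟨2 * (l : ℤ), by ring⟩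
    have hβint : IsIntegral ℤ β := IsIntegral.sum _ fun l _ =>
      (isIntegral_algebraMap (R := ℤ) (x := p (1 + 4 * l))).mul (ZMod.isIntegral_stdAddChar _)
    refine not_isIntegral_half_of_odd (((Int.odd_coe_nat N).mpr hN).mul ho) ?_
    have hint := (((isIntegral_charEig_one_div_two hn hN hD (σ := σ)).mul hβint).mul
      (isIntegral_hermRow n (symbol n D σ) x)).neg
    have heq : (((N * o : ℤ) : ℂ)) / 2 = -(charEig n (symbol n D σ) 1 / 2 * β *
        hermRow n (symbol n D σ) x) := by
      push_cast
      linear_combination (-(hermRow n (symbol n D σ) x) / 4) * hkey +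
        (N * o / 2 : ℂ) * hermRow_sq_eq_neg_one n (symbol n D σ) h0
    rw [heq]
    exact hint
  have hsub : ∀ d ∈ D, padicValNat 2 (n / d) = 2 → d = n / 4 := by
    intro d hd hd2
    obtain ⟨M, hM⟩ := hD d hd
    have hdn : n = d * (4 * M) := by
      rw [← Nat.div_mul_cancel hn4, hM]; ring
    have hd0 : 0 < d := Nat.pos_of_ne_zero fun h => hn0 (by rw [hdn, h, zero_mul])
    have hM0 : M ≠ 0 := fun h => hn0 (by rw [hdn, h, mul_zero, mul_zero])
    rw [hdn, Nat.mul_div_cancel_left _ hd0, padicValNat_two_eq_two_iff hM0] at hd2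
    have hdM : d * M = 2 ^ a * N := hM.symm.trans haN
    have hc : Nat.Coprime (2 ^ a) M := Nat.Coprime.pow_left _ (Nat.coprime_two_left.mpr hd2)
    obtain ⟨e, rfl⟩ : 2 ^ a ∣ d := hc.dvd_of_dvd_mul_right ⟨N, hdM⟩
    rw [mul_assoc] at hdM
    have heM := Nat.eq_of_mul_eq_mul_left (by positivity) hdM
    have heN : N ∣ e := by
      by_contra hne
      have he : Odd e := Nat.Odd.of_mul_left (heM ▸ hN)
      have h0 := hvanish ((Int.odd_coe_nat e).mpr he) (by exact_mod_cast hne)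
      have h1 := hermRow_symbol_mul σ hd hdn isCoprime_one_left
      rw [mul_one] at h1
      push_cast at h0 h1
      rw [h0] at h1
      split_ifs at h1 <;> simp [eq_comm] at h1
    rw [haN, Nat.dvd_antisymm ⟨M, heM.symm⟩ heN]
  refine eq_singleton_iff_nonempty_unique_mem.mpr ⟨?_, fun d hd => ?_⟩
  · by_contra hempty
    rw [not_nonempty_iff_eq_empty] at hempty
    have hμ : charEig n (symbol n D σ) 1 = 0 := by
      have h1 := charEig_odd h2 (symbol n D σ) odd_one
      rw [Int.cast_one] at h1
      rw [h1]
      refine sum_eq_zero fun z _ => ?_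
      rcases antiRow_symbol_eq_zero_or hn hN hD (σ := σ) z with h | ⟨y, hy, rfl⟩
      · rw [h, zero_mul]
      rw [antiRow_symbol_of_odd hn hN hD hy]
      by_contra hne
      obtain ⟨d, hd, M, hdn, k, hk, hz⟩ :=
        exists_eq_mul_of_hermRow_symbol_ne_zero hn4 hD (left_ne_zero_of_mul hne)
      have hsign := hermRow_symbol_mul_add_half σ hd hdn hk
      rw [← hz, hermRow_symbol_add_half_of_odd hn hN hD hy] at hsign
      have hM : Odd M := by
        rw [← Nat.not_even_iff_odd]
        intro hM
        rw [hM.neg_one_pow, one_mul, neg_eq_self] at hsign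
        exact left_ne_zero_of_mul hne hsign
      have hd0 : 0 < d := Nat.pos_of_ne_zero fun h => hn0 (by rw [hdn, h, zero_mul])
      have hmem : d ∈ D.filter (fun d => padicValNat 2 (n / d) = 2) := by
        refine mem_filter.mpr ⟨hd, ?_⟩
        rw [hdn, Nat.mul_div_cancel_left _ hd0, padicValNat_two_eq_two_iff hM.pos.ne']
        exact hM
      rw [hempty] at hmem
      exact notMem_empty _ hmem
    have := h 1 odd_one
    rw [Int.cast_one, hμ, mul_zero, Complex.exp_zero] at this
    norm_num at this
  · exact hsub d (mem_filter.mp hd).1 (mem_filter.mp hd).2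
theorem hermRow_symbol_neg {n : ℕ} [NeZero n] {D : Finset ℕ} {σ : ℕ → ℤ} (hn4 : 4 ∣ n)
    (hD : ∀ d ∈ D, d ∣ n / 4) (x : ZMod n) :
    hermRow n (symbol n D σ) (-x) = -hermRow n (symbol n D σ) x := by
  have main {x : ZMod n} (h0 : hermRow n (symbol n D σ) x ≠ 0) :
      hermRow n (symbol n D σ) (-x) = -hermRow n (symbol n D σ) x := by
    obtain ⟨d, hd, M, hdn, k, hk, rfl⟩ := exists_eq_mul_of_hermRow_symbol_ne_zero hn4 hD h0
    rw [show -((d * k : ℤ) : ZMod n) = ((d * -k : ℤ) : ZMod n) by push_cast; ring,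
      hermRow_symbol_mul σ hd hdn hk, hermRow_symbol_mul σ hd hdn hk.neg_left]
    have hχ : ZMod.χ₄ ((-k : ℤ) : ZMod 4) = -ZMod.χ₄ (k : ZMod 4) := by
      rw [Int.cast_neg, ← neg_one_mul, map_mul, show ZMod.χ₄ (-1) = -1 by decide, neg_one_mul]
    rw [hχ]
    push_cast
    ring
  by_cases h0 : hermRow n (symbol n D σ) x = 0
  · by_contra hne
    rw [h0, neg_zero] at hne
    have := main hne
    rw [neg_neg, h0, eq_comm, neg_eq_zero] at this
    exact hne this
  · exact main h0

theorem charEig_symbol_zero {n : ℕ} [NeZero n] {D : Finset ℕ} {σ : ℕ → ℤ} (hn4 : 4 ∣ n)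
    (hD : ∀ d ∈ D, d ∣ n / 4) : charEig n (symbol n D σ) 0 = 0 := by
  have h : charEig n (symbol n D σ) 0 = -charEig n (symbol n D σ) 0 := by
    simp only [charEig, zero_mul, AddChar.map_zero_eq_one, mul_one]
    rw [← sum_neg_distrib, ← Equiv.sum_comp (Equiv.neg (ZMod n))]
    exact sum_congr rfl fun x _ => hermRow_symbol_neg hn4 hD x
  exact self_eq_neg.mp h

/-- The contribution of the vertices `a` with `gcd(a, n) = d` to the eigenvalue at `j`. -/
def gcdSineSum (n : ℕ) [NeZero n] (d : ℕ) (j : ZMod n) : ℂ :=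
  ∑ a ∈ range n with Nat.gcd a n = d,
    (ZMod.χ₄ ((a / d : ℕ) : ZMod 4) : ℂ) * (Complex.I * ZMod.stdAddChar (j * (a : ZMod n)))

theorem charEig_symbol_eq_sum {n : ℕ} [NeZero n] {D : Finset ℕ} {σ : ℕ → ℤ} (hn4 : 4 ∣ n)
    (hD : ∀ d ∈ D, d ∣ n / 4) (j : ZMod n) :
    charEig n (symbol n D σ) j =
      ∑ d ∈ D, (if σ d = 1 then 1 else -1 : ℤ) • gcdSineSum n d j := by
  have hdvd : ∀ d ∈ D, d ∈ n.divisors := fun d hd =>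
    Nat.mem_divisors.mpr ⟨(hD d hd).trans (Nat.div_dvd_of_dvd hn4), NeZero.ne n⟩
  rw [charEig, ZMod.sum_eq_sum_range, ← sum_fiberwise_of_maps_to (t := n.divisors)
    (g := fun a => Nat.gcd a n)
    fun a _ => Nat.mem_divisors.mpr ⟨Nat.gcd_dvd_right a n, NeZero.ne n⟩]
  refine (sum_subset hdvd fun d _ hd => ?_).symm.trans (sum_congr rfl fun d hd => ?_)
  · refine sum_eq_zero fun a ha => ?_
    rw [mem_filter, mem_range] at ha
    by_contra hne
    obtain ⟨e, he, M, hen, k, hk, ha'⟩ :=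
      exists_eq_mul_of_hermRow_symbol_ne_zero hn4 hD (left_ne_zero_of_mul hne)
    have hgcd : Nat.gcd a n = e := by
      have hmod := (ZMod.intCast_eq_intCast_iff' (a : ℤ) (e * k) n).mp (by exact_mod_cast ha')
      rw [← Int.gcd_natCast_natCast, ← Int.gcd_emod, hmod, Int.gcd_emod, hen, Nat.cast_mul e,
        Int.gcd_mul_left, Int.isCoprime_iff_gcd_eq_one.mp hk, mul_one, Int.natAbs_natCast]
    exact hd (ha.2 ▸ hgcd ▸ he)
  · obtain ⟨M, hM⟩ := hD d hd
    have hdn : n = d * (4 * M) := by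
      rw [← Nat.div_mul_cancel hn4, hM]; ring
    have hd0 : 0 < d := Nat.pos_of_ne_zero fun h => NeZero.ne n (by rw [hdn, h, zero_mul])
    rw [gcdSineSum, smul_sum]
    refine sum_congr rfl fun a ha => ?_
    rw [mem_filter, mem_range] at ha
    obtain ⟨k, rfl⟩ : d ∣ a := ha.2 ▸ Nat.gcd_dvd_left a n
    have hk : IsCoprime (k : ℤ) (4 * M : ℕ) := by
      rw [Nat.isCoprime_iff_coprime]
      have hg := ha.2
      rw [hdn, Nat.gcd_mul_left] at hg
      exact Nat.eq_of_mul_eq_mul_left hd0 (hg.trans (mul_one d).symm)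
    have hrow := hermRow_symbol_mul σ hd hdn hk
    rw [show ((d * k : ℤ) : ZMod n) = ((d * k : ℕ) : ZMod n) by push_cast; ring] at hrow
    rw [hrow, Nat.mul_div_cancel_left _ hd0, zsmul_eq_mul]
    push_cast
    ring

theorem sum_range_four_mul {α : Type*} [AddCommMonoid α] (g : ℕ → α) (M : ℕ) :
    ∑ k ∈ range (4 * M), g k =
      ∑ l ∈ range M, (g (4 * l) + g (4 * l + 1) + g (4 * l + 2) + g (4 * l + 3)) := by
  induction M with
  | zero => simp
  | succ M ih =>
    rw [show 4 * (M + 1) = 4 * M + 1 + 1 + 1 + 1 by ring, sum_range_succ, sum_range_succ,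
      sum_range_succ, sum_range_succ, sum_range_succ (n := M), ih]
    simp only [add_assoc]

/-- The analogue of `gcdSineSum` over all multiples of `d`. -/
def dvdSineSum (n : ℕ) [NeZero n] (d : ℕ) (j : ZMod n) : ℂ :=
  ∑ a ∈ range n with d ∣ a,
    (ZMod.χ₄ ((a / d : ℕ) : ZMod 4) : ℂ) * (Complex.I * ZMod.stdAddChar (j * (a : ZMod n)))

theorem dvdSineSum_eq {n d M : ℕ} [NeZero n] (hn : n = d * (4 * M)) (j : ZMod n) :
    dvdSineSum n d j = Complex.I * (ZMod.stdAddChar (j * (d : ZMod n)) - ZMod.stdAddChar (j * (d : ZMod n)) ^ 3) *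
      ∑ l ∈ range M, ZMod.stdAddChar (4 * (j * (d : ZMod n))) ^ l := by
  have hd0 : 0 < d := Nat.pos_of_ne_zero fun h => NeZero.ne n (by rw [hn, h, zero_mul])
  have hre : dvdSineSum n d j = ∑ k ∈ range (4 * M),
      (ZMod.χ₄ (k : ZMod 4) : ℂ) * (Complex.I * ZMod.stdAddChar (j * (d : ZMod n)) ^ k) := by
    refine sum_bij' (fun a _ => a / d) (fun k _ => d * k) ?_ ?_ ?_ ?_ ?_
    · intro a ha
      rw [mem_filter, mem_range] at ha
      rw [mem_range, Nat.div_lt_iff_lt_mul hd0, mul_comm, ← hn]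
      exact ha.1
    · intro k hk
      rw [mem_range] at hk
      rw [mem_filter, mem_range]
      refine ⟨?_, dvd_mul_right d k⟩
      conv_rhs => rw [hn]
      exact Nat.mul_lt_mul_of_pos_left hk hd0
    · exact fun a ha => Nat.mul_div_cancel' (mem_filter.mp ha).2
    · exact fun k _ => Nat.mul_div_cancel_left k hd0
    · intro a ha
      obtain ⟨k, rfl⟩ := (mem_filter.mp ha).2
      rw [Nat.mul_div_cancel_left k hd0, ← AddChar.map_nsmul_eq_pow, nsmul_eq_mul]
      congr 3
      push_cast
      ring
  rw [hre, sum_range_four_mul, mul_sum]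
  refine sum_congr rfl fun l _ => ?_
  have h4 : (ZMod.stdAddChar (4 * (j * (d : ZMod n))) : ℂ) = ZMod.stdAddChar (j * (d : ZMod n)) ^ 4 := by
    rw [← AddChar.map_nsmul_eq_pow, nsmul_eq_mul]
    norm_num
  have e4 : (4 : ZMod 4) = 0 := rfl
  push_cast
  rw [e4, zero_mul, zero_add, zero_add, zero_add, show ZMod.χ₄ 0 = 0 by decide,
    show ZMod.χ₄ 1 = 1 by decide, show ZMod.χ₄ 2 = 0 by decide,
    show ZMod.χ₄ 3 = -1 by decide, h4]
  push_cast
  ring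

theorem dvdSineSum_mem_zmultiples {n d M : ℕ} [NeZero n] (hn : n = d * (4 * M)) (hM : Even M)
    (j : ZMod n) : dvdSineSum n d j ∈ AddSubgroup.zmultiples (4 : ℂ) := by
  rw [dvdSineSum_eq hn]
  set w : ℂ := ZMod.stdAddChar (j * (d : ZMod n)) with hw
  have h4 : (ZMod.stdAddChar (4 * (j * (d : ZMod n))) : ℂ) = w ^ 4 := by
    rw [← AddChar.map_nsmul_eq_pow, nsmul_eq_mul]
    norm_num
  rw [h4]
  by_cases h1 : w ^ 4 = 1
  · obtain ⟨c, rfl⟩ := hM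
    have hfac : (w ^ 2 - 1) * (w ^ 2 - Complex.I ^ 2) = 0 := by
      rw [Complex.I_sq]
      linear_combination h1
    simp only [h1, one_pow, sum_const, card_range, nsmul_eq_mul, mul_one]
    rcases mul_eq_zero.mp hfac with h | h
    · rw [show w - w ^ 3 = 0 by linear_combination -w * h, mul_zero, zero_mul]
      exact zero_mem _
    · rcases sq_eq_sq_iff_eq_or_eq_neg.mp (sub_eq_zero.mp h) with h | h
      · refine AddSubgroup.mem_zmultiples_iff.mpr ⟨-c, ?_⟩
        rw [h, zsmul_eq_mul]
        push_cast
        linear_combination (2 * c * (Complex.I ^ 2 - 2) : ℂ) * Complex.I_sq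
      · refine AddSubgroup.mem_zmultiples_iff.mpr ⟨c, ?_⟩
        rw [h, zsmul_eq_mul]
        push_cast
        linear_combination (-2 * c * (Complex.I ^ 2 - 2) : ℂ) * Complex.I_sq
  · rw [geom_sum_eq_zero _ h1, mul_zero]
    · exact zero_mem _
    · rw [← pow_mul, hw, ← AddChar.map_nsmul_eq_pow, nsmul_eq_mul,
        show ((4 * M : ℕ) : ZMod n) * (j * (d : ZMod n)) = j * ((d * (4 * M) : ℕ) : ZMod n) by
          push_cast; ring, ← hn, ZMod.natCast_self, mul_zero, AddChar.map_zero_eq_one]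

theorem dvdSineSum_sub_gcdSineSum_mem {n d M : ℕ} [NeZero n] (hn : n = d * (4 * M)) (j : ZMod n)
    (S : AddSubgroup ℂ)
    (hS : ∀ g M' : ℕ, Odd g → g ≠ 1 → M = g * M' → gcdSineSum n (d * g) j ∈ S) :
    dvdSineSum n d j - gcdSineSum n d j ∈ S := by
  have hn0 : n ≠ 0 := NeZero.ne n
  have hd0 : 0 < d := Nat.pos_of_ne_zero fun h => hn0 (by rw [hn, h, zero_mul])
  have hdmem : d ∈ n.divisors := Nat.mem_divisors.mpr ⟨⟨_, hn⟩, hn0⟩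
  have hfib : ∀ e ∈ n.divisors, d ∣ e →
      ({a ∈ range n | d ∣ a} : Finset ℕ).filter (fun a => Nat.gcd a n = e) =
        {a ∈ range n | Nat.gcd a n = e} := by
    intro e _ hde
    ext a
    simp only [mem_filter]
    constructor
    · rintro ⟨⟨ha, -⟩, hg⟩
      exact ⟨ha, hg⟩
    · rintro ⟨ha, hg⟩
      exact ⟨⟨ha, hde.trans (hg ▸ Nat.gcd_dvd_left a n)⟩, hg⟩
  rw [dvdSineSum, ← sum_fiberwise_of_maps_to (t := n.divisors) (g := fun a => Nat.gcd a n)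
    fun a _ => Nat.mem_divisors.mpr ⟨Nat.gcd_dvd_right a n, NeZero.ne n⟩,
    ← add_sum_erase _ _ hdmem, hfib d hdmem dvd_rfl, gcdSineSum, add_sub_cancel_left]
  refine sum_mem fun e he => ?_
  rw [mem_erase] at he
  by_cases hde : d ∣ e
  · rw [hfib e he.2 hde]
    obtain ⟨g, rfl⟩ := hde
    have hdvd : d * g ∣ n := Nat.dvd_of_mem_divisors he.2
    have hterm : ∀ a ∈ ({a ∈ range n | Nat.gcd a n = d * g} : Finset ℕ),
        (ZMod.χ₄ ((a / d : ℕ) : ZMod 4) : ℂ) * (Complex.I * ZMod.stdAddChar (j * (a : ZMod n))) =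
        ZMod.χ₄ (g : ZMod 4) • ((ZMod.χ₄ ((a / (d * g) : ℕ) : ZMod 4) : ℂ) *
          (Complex.I * ZMod.stdAddChar (j * (a : ZMod n)))) := by
      intro a ha
      rw [mem_filter] at ha
      obtain ⟨k, rfl⟩ : d * g ∣ a := ha.2 ▸ Nat.gcd_dvd_left a n
      rw [Nat.mul_div_cancel_left k (Nat.pos_of_dvd_of_pos hdvd (Nat.pos_of_ne_zero hn0)),
        mul_assoc d, Nat.mul_div_cancel_left _ hd0, Nat.cast_mul g k, map_mul, zsmul_eq_mul]
      push_cast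
      ring
    rw [sum_congr rfl hterm, ← smul_sum]
    rcases Nat.even_or_odd g with hg | hg
    · rw [ZMod.χ₄_nat_eq_if_mod_four, if_pos (Nat.even_iff.mp hg), zero_smul]
      exact zero_mem _
    · refine zsmul_mem ?_ _
      have hgM : g ∣ M := by
        have h4 : g ∣ 4 * M := by
          conv_rhs at hdvd => rw [hn]
          exact Nat.dvd_of_mul_dvd_mul_left hd0 hdvd
        have hc : Nat.Coprime g 4 := Nat.Coprime.pow_right 2 (Nat.coprime_two_right.mpr hg)
        exact hc.dvd_of_dvd_mul_left h4
      obtain ⟨M', hM'⟩ := hgM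
      exact hS g M' hg (fun h => he.1 (by rw [h, mul_one])) hM'
  · rw [sum_eq_zero]
    · exact zero_mem _
    · intro a ha
      rw [mem_filter, mem_filter] at ha
      exact absurd (ha.2 ▸ Nat.dvd_gcd ha.1.2 ⟨_, hn⟩) hde

theorem gcdSineSum_mem_zmultiples {n : ℕ} [NeZero n] (j : ZMod n) {M : ℕ} :
    ∀ {d : ℕ}, n = d * (4 * M) → Even M →
      gcdSineSum n d j ∈ AddSubgroup.zmultiples (4 : ℂ) := by
  induction M using Nat.strong_induction_on with
  | _ M ih =>
    intro d hn hM
    have hM0 : M ≠ 0 := fun h => NeZero.ne n (by rw [hn, h, mul_zero, mul_zero])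
    rw [← sub_sub_cancel (dvdSineSum n d j) (gcdSineSum n d j)]
    refine sub_mem (dvdSineSum_mem_zmultiples hn hM j)
      (dvdSineSum_sub_gcdSineSum_mem hn j _ fun g M' hg hg1 hgM => ?_)
    have hlt : M' < M := by
      have hM'0 : 0 < M' := Nat.pos_of_ne_zero fun h => hM0 (by rw [hgM, h, mul_zero])
      have hg2 : 2 ≤ g := by
        rcases hg with ⟨c, rfl⟩
        omega
      nlinarith
    refine ih M' hlt (by rw [hn, hgM]; ring) ?_
    rw [hgM, Nat.even_mul] at hM
    exact hM.resolve_left (Nat.not_even_iff_odd.mpr hg)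

theorem gcdSineSum_quarter {n : ℕ} [NeZero n] (hn4 : 4 ∣ n) (j : ZMod n) :
    gcdSineSum n (n / 4) j = Complex.I * (ZMod.stdAddChar (j * ((n / 4 : ℕ) : ZMod n)) -
      ZMod.stdAddChar (j * ((n / 4 : ℕ) : ZMod n)) ^ 3) := by
  have hn : n = n / 4 * (4 * 1) := (Nat.div_mul_cancel hn4).symm
  have hmem := dvdSineSum_sub_gcdSineSum_mem hn j ⊥ fun g M' _ hg1 h =>
    absurd (Nat.eq_one_of_mul_eq_one_right h.symm) hg1
  rw [AddSubgroup.mem_bot, sub_eq_zero] at hmem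
  rw [← hmem, dvdSineSum_eq hn]
  simp

theorem exp_pi_div_two_mul_eq_one {z : ℂ} (hz : z ∈ AddSubgroup.zmultiples (4 : ℂ)) :
    Complex.exp (Complex.I * (Real.pi / 2 : ℝ) * z) = 1 := by
  obtain ⟨m, rfl⟩ := AddSubgroup.mem_zmultiples_iff.mp hz
  rw [Complex.exp_eq_one_iff]
  refine ⟨m, ?_⟩
  rw [zsmul_eq_mul]
  push_cast
  ring

theorem exp_charEig_of_filter_eq {n : ℕ} [NeZero n] (hn4 : 4 ∣ n) {D : Finset ℕ} {σ : ℕ → ℤ}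
    (hD : ∀ d ∈ D, d ∣ n / 4)
    (h : D.filter (fun d => padicValNat 2 (n / d) = 2) = {n / 4}) (j : ZMod n) :
    Complex.exp (Complex.I * (Real.pi / 2 : ℝ) * charEig n (symbol n D σ) j) =
      ZMod.stdAddChar (j * ((n / 2 : ℕ) : ZMod n)) := by
  have hmem : n / 4 ∈ D := (mem_filter.mp (h ▸ mem_singleton_self (n / 4))).1
  have hrest : ∑ d ∈ D.erase (n / 4), (if σ d = 1 then 1 else -1 : ℤ) • gcdSineSum n d j ∈
      AddSubgroup.zmultiples (4 : ℂ) := by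
    refine sum_mem fun d hd => zsmul_mem ?_ _
    rw [mem_erase] at hd
    obtain ⟨M, hM⟩ := hD d hd.2
    have hdn : n = d * (4 * M) := by
      rw [← Nat.div_mul_cancel hn4, hM]; ring
    have hd0 : 0 < d := Nat.pos_of_ne_zero fun h => NeZero.ne n (by rw [hdn, h, zero_mul])
    have hM0 : M ≠ 0 := fun h => NeZero.ne n (by rw [hdn, h, mul_zero, mul_zero])
    refine gcdSineSum_mem_zmultiples j hdn ?_
    by_contra hodd
    have : d ∈ D.filter (fun d => padicValNat 2 (n / d) = 2) := by
      refine mem_filter.mpr ⟨hd.2, ?_⟩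
      rw [hdn, Nat.mul_div_cancel_left _ hd0, padicValNat_two_eq_two_iff hM0]
      exact Nat.not_even_iff_odd.mp hodd
    rw [h, mem_singleton] at this
    exact hd.1 this
  have hsq : (ZMod.stdAddChar (j * ((n / 2 : ℕ) : ZMod n)) : ℂ) =
      ZMod.stdAddChar (j * ((n / 4 : ℕ) : ZMod n)) ^ 2 := by
    rw [← AddChar.map_nsmul_eq_pow, show n / 2 = 2 * (n / 4) by omega, nsmul_eq_mul]
    congr 1
    push_cast
    ring
  have hfour : ((ZMod.stdAddChar (j * ((n / 4 : ℕ) : ZMod n)) : ℂ) ^ 2) ^ 2 = 1 := by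
    rw [← hsq, ← AddChar.map_nsmul_eq_pow, two_nsmul, ← mul_add,
      half_add_half (dvd_trans (by norm_num) hn4), mul_zero, AddChar.map_zero_eq_one]
  rw [charEig_symbol_eq_sum hn4 hD, ← add_sum_erase _ _ hmem, mul_add, Complex.exp_add,
    exp_pi_div_two_mul_eq_one hrest, mul_one, gcdSineSum_quarter hn4, hsq]
  generalize (ZMod.stdAddChar (j * ((n / 4 : ℕ) : ZMod n)) : ℂ) = w at hfour
  rcases sq_eq_one_iff.mp hfour with hw | hw
  · rw [show w - w ^ 3 = 0 by linear_combination -w * hw, hw]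
    simp
  · rw [show w - w ^ 3 = 2 * w by linear_combination -w * hw, hw]
    have hwI : w = Complex.I ∨ w = -Complex.I :=
      sq_eq_sq_iff_eq_or_eq_neg.mp (hw.trans Complex.I_sq.symm)
    have hpos : Complex.exp (Complex.I * Real.pi) = -1 := by
      rw [mul_comm, Complex.exp_pi_mul_I]
    have hneg : Complex.exp (-(Complex.I * Real.pi)) = -1 := by
      rw [Complex.exp_neg, hpos]; norm_num
    have hval : Complex.I * ((Real.pi / 2 : ℝ) : ℂ) *
        ((if σ (n / 4) = 1 then 1 else -1 : ℤ) • (Complex.I * (2 * w))) = Complex.I * Real.pi ∨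
        Complex.I * ((Real.pi / 2 : ℝ) : ℂ) *
        ((if σ (n / 4) = 1 then 1 else -1 : ℤ) • (Complex.I * (2 * w))) =
          -(Complex.I * Real.pi) := by
      by_cases hs : σ (n / 4) = 1 <;> rcases hwI with rfl | rfl
      · right
        simp only [if_pos hs, one_smul]
        push_cast
        linear_combination (Complex.I * Real.pi) * Complex.I_sq
      · left
        simp only [if_pos hs, one_smul]
        push_cast
        linear_combination -(Complex.I * Real.pi) * Complex.I_sq
      · left
        simp only [if_neg hs, neg_smul, one_smul]
        push_cast
        linear_combination -(Complex.I * Real.pi) * Complex.I_sq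
      · right
        simp only [if_neg hs, neg_smul, one_smul]
        push_cast
        linear_combination (Complex.I * Real.pi) * Complex.I_sq
    rcases hval with hv | hv
    · rw [hv, hpos]
    · rw [hv, hneg]

theorem pst_iff_D2 (n : ℕ) [NeZero n] (hn4 : 4 ∣ n)
    (D : Finset ℕ) (hD : ∀ d ∈ D, d ∣ n / 4)
    (σ : ℕ → ℤ) (hσ : ∀ d ∈ D, σ d = 1 ∨ σ d = -1) :
    (∀ b : ZMod n, hasPST n (symbol n D σ) (b + (n / 2 : ℕ)) b) ↔
      D.filter (fun d => padicValNat 2 (n / d) = 2) = {n / 4} := by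
  have h2 : 2 ∣ n := dvd_trans (by norm_num) hn4
  constructor
  · intro h
    obtain ⟨t, γ, -, ht⟩ := (hasPST_iff _ _ _ _).mp (h 0)
    have hγ : γ = 1 := by
      have := ht 0
      simp only [charEig_symbol_zero hn4 hD, mul_zero, Complex.exp_zero, zero_mul, neg_zero,
        AddChar.map_zero_eq_one, mul_one] at this
      exact this.symm
    refine filter_eq_of_exp_charEig hn4 hD (σ := σ) (t := t) fun j hj => ?_
    have := ht j
    rw [hγ, zero_add, mul_zero, neg_zero, AddChar.map_zero_eq_one, AddChar.map_neg_eq_inv,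
      ZMod.stdAddChar_odd_mul_half h2 hj] at this
    have h1 : ((-1 : ℂ))⁻¹ = -1 := by norm_num
    rw [h1] at this
    linear_combination -this
  · intro h b
    refine (hasPST_iff _ _ _ _).mpr ⟨Real.pi / 2, 1, norm_one, fun j => ?_⟩
    rw [exp_charEig_of_filter_eq hn4 hD h j, ← AddChar.map_add_eq_mul, one_mul]
    congr 1
    ring

end
end

section
/- Let n be a positive integer divisible by 4 and let Γ = IOCG_n(D,σ) be an integral oriented circulant graph. Then the following are equivalent: (i) for every b ∈ Z_n, Γ has multiple state transfer on the vertex set {b, b + n/4, b + n/2, b + 3n/4}; (ii) n is divisible by 8, D₂ = {n/4}, and D₃ = {n/8}, i.e. {d ∈ D : ν₂(n/d) = 2} = {n/4} and {d ∈ D : ν₂(n/d) = 3} = {n/8}. -/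
open Complex Finset

noncomputable section

open ZMod in
theorem four_dvd_sub_chi_of_odd {k : ℕ} (hk : Odd k) : (4 : ℤ) ∣ k - χ₄ (k : ZMod 4) := by
  rw [χ₄_nat_eq_if_mod_four]
  have := Nat.odd_iff.1 hk
  split_ifs <;> omega

theorem chi_eq_zero_of_not_odd {k : ℕ} (hk : ¬ Odd k) : ZMod.χ₄ (k : ZMod 4) = 0 := by
  rw [ZMod.χ₄_nat_eq_if_mod_four, if_pos]
  rw [Nat.odd_iff] at hk
  omega

/-- Every function on the divisors of `N` is a `χ₄`-twisted sum over multiples. -/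
theorem exists_chi_weights (N : ℕ) (G : ℕ → ℤ) : ∃ β : ℕ → ℤ, ∀ x ∈ N.divisors,
    G x = ∑ m ∈ N.divisors with x ∣ m, ZMod.χ₄ ((m / x : ℕ) : ZMod 4) * β m := by
  suffices H : ∀ r : ℕ, ∃ β : ℕ → ℤ, ∀ x ∈ N.divisors, N - r ≤ x →
      G x = ∑ m ∈ N.divisors with x ∣ m, ZMod.χ₄ ((m / x : ℕ) : ZMod 4) * β m by
    obtain ⟨β, hβ⟩ := H N
    exact ⟨β, fun x hx => hβ x hx (by omega)⟩
  have key : ∀ (β : ℕ → ℤ) (x : ℕ), x ∈ N.divisors →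
      ∑ m ∈ N.divisors with x ∣ m, ZMod.χ₄ ((m / x : ℕ) : ZMod 4) * β m = β x +
        ∑ m ∈ N.divisors with x ∣ m ∧ x ≠ m, ZMod.χ₄ ((m / x : ℕ) : ZMod 4) * β m := by
    intro β x hx
    have hx0 : 0 < x := Nat.pos_of_mem_divisors hx
    rw [← Finset.add_sum_erase _ _ (Finset.mem_filter.2 ⟨hx, dvd_refl x⟩), Nat.div_self hx0]
    congr 1
    · simp
    · refine Finset.sum_congr ?_ fun _ _ => rfl
      ext m
      simp only [Finset.mem_erase, Finset.mem_filter]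
      tauto
  have hlt : ∀ x m, m ∈ N.divisors.filter (fun m => x ∣ m ∧ x ≠ m) → x < m := by
    intro x m hm
    obtain ⟨hm, hxm, hne⟩ := Finset.mem_filter.1 hm
    exact lt_of_le_of_ne (Nat.le_of_dvd (Nat.pos_of_mem_divisors hm) hxm) hne
  intro r
  induction r with
  | zero =>
    refine ⟨G, fun x hx hle => ?_⟩
    rw [key G x hx, Finset.sum_eq_zero, add_zero]
    intro m hm
    have := hlt x m hm
    have := Nat.divisor_le (Finset.mem_filter.1 hm).1
    omega
  | succ r ih =>
    obtain ⟨β, hβ⟩ := ih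
    by_cases hr : N ≤ r
    · exact ⟨β, fun x hx _ => hβ x hx (by omega)⟩
    refine ⟨Function.update β (N - (r + 1)) (G (N - (r + 1)) -
      ∑ m ∈ N.divisors with (N - (r + 1)) ∣ m ∧ (N - (r + 1)) ≠ m,
        ZMod.χ₄ ((m / (N - (r + 1)) : ℕ) : ZMod 4) * β m), fun x hx hle => ?_⟩
    have hs : ∑ m ∈ N.divisors with x ∣ m ∧ x ≠ m, ZMod.χ₄ ((m / x : ℕ) : ZMod 4) *
        Function.update β (N - (r + 1)) (G (N - (r + 1)) -
          ∑ m ∈ N.divisors with (N - (r + 1)) ∣ m ∧ (N - (r + 1)) ≠ m,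
            ZMod.χ₄ ((m / (N - (r + 1)) : ℕ) : ZMod 4) * β m) m =
        ∑ m ∈ N.divisors with x ∣ m ∧ x ≠ m, ZMod.χ₄ ((m / x : ℕ) : ZMod 4) * β m := by
      refine Finset.sum_congr rfl fun m hm => ?_
      have := hlt x m hm
      rw [Function.update_of_ne (by omega)]
    rw [key _ x hx, hs]
    rcases eq_or_ne x (N - (r + 1)) with rfl | hne
    · rw [Function.update_self]
      ring
    · rw [Function.update_of_ne hne, ← key β x hx]
      exact hβ x hx (by omega)

/-- The integer `∑_{m ∣ gcd(k, N)} m χ₄(k / m) β(m)`. -/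
def chiSum (N : ℕ) (β : ℕ → ℤ) (k : ℕ) : ℤ :=
  ∑ m ∈ N.divisors with m ∣ k, m * ZMod.χ₄ ((k / m : ℕ) : ZMod 4) * β m

theorem exists_odd_mul_of_odd_div {s k m : ℕ} (hk : Odd k) (hm : m ∣ 2 ^ s * k)
    (ho : Odd (2 ^ s * k / m)) : ∃ l, Odd l ∧ m = 2 ^ s * l := by
  obtain ⟨o, h⟩ := hm
  have hm0 : 0 < m := by
    rcases Nat.eq_zero_or_pos m with rfl | h0
    · simp at ho
    · exact h0
  rw [h, Nat.mul_div_cancel_left _ hm0] at ho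
  have h2 : 2 ^ s ∣ m :=
    (Nat.Coprime.pow_left s (Nat.coprime_two_left.2 ho)).dvd_of_dvd_mul_right ⟨k, h.symm⟩
  obtain ⟨l, rfl⟩ := h2
  refine ⟨l, ?_, rfl⟩
  rw [mul_assoc] at h
  have := Nat.eq_of_mul_eq_mul_left (by positivity) h
  rw [this] at hk
  exact (Nat.odd_mul.1 hk).1

theorem odd_div_of_odd_mul_div {s k m : ℕ} (hk : Odd k) (hm : 2 ^ s * k ∣ m)
    (ho : Odd (m / (2 ^ s * k))) : ∃ l, Odd l ∧ m = 2 ^ s * l := by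
  obtain ⟨o, rfl⟩ := hm
  rw [Nat.mul_div_cancel_left _ (Nat.mul_pos (by positivity) hk.pos)] at ho
  exact ⟨k * o, hk.mul ho, by ring⟩

/-- If `chiSum` is linear modulo `2 ^ (s + r)` on the odd multiples of `2 ^ s`, then the weights at
proper odd multiples of `2 ^ s` vanish modulo `2 ^ r`. -/
theorem dvd_weight_of_chiSum {N : ℕ} (hN : N ≠ 0) {β : ℕ → ℤ} (s r : ℕ)
    (h4 : (2 : ℤ) ^ r ∣ 4 * β (2 ^ s))
    (hE : ∀ k, Odd k → 2 ^ s * k ∣ N →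
      (2 : ℤ) ^ s * 2 ^ r ∣ chiSum N β (2 ^ s * k) - 2 ^ s * k * β (2 ^ s)) :
    ∀ k, Odd k → k ≠ 1 → 2 ^ s * k ∣ N → (2 : ℤ) ^ r ∣ β (2 ^ s * k) := by
  intro k
  induction k using Nat.strong_induction_on with
  | _ k ih =>
  intro hk hk1 hkN
  have hk0 := hk.pos
  have hc0 : 0 < 2 ^ s := by positivity
  have hmem : 2 ^ s * k ∈ N.divisors.filter (fun m => m ∣ 2 ^ s * k) := by
    simp [hkN, hN]
  have hmem' : 2 ^ s ∈ (N.divisors.filter (fun m => m ∣ 2 ^ s * k)).erase (2 ^ s * k) := by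
    simp only [Finset.mem_erase, Finset.mem_filter, Nat.mem_divisors]
    refine ⟨fun h => hk1 ?_, ⟨(Dvd.intro _ rfl).trans hkN, hN⟩, Dvd.intro _ rfl⟩
    exact Nat.eq_of_mul_eq_mul_left hc0 (by rw [← h, mul_one])
  have hE' := hE k hk hkN
  rw [chiSum, ← Finset.add_sum_erase _ _ hmem, ← Finset.add_sum_erase _ _ hmem',
    Nat.div_self (Nat.mul_pos hc0 hk0), Nat.mul_div_cancel_left _ hc0] at hE'
  have hrest : (2 : ℤ) ^ s * 2 ^ r ∣ ∑ m ∈ ((N.divisors.filter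
      (fun m => m ∣ 2 ^ s * k)).erase (2 ^ s * k)).erase (2 ^ s),
      (m : ℤ) * ZMod.χ₄ ((2 ^ s * k / m : ℕ) : ZMod 4) * β m := by
    refine Finset.dvd_sum fun m hm => ?_
    simp only [Finset.mem_erase, Finset.mem_filter, Nat.mem_divisors] at hm
    obtain ⟨hm1, hm2, ⟨hm3, -⟩, hm4⟩ := hm
    by_cases ho : Odd (2 ^ s * k / m)
    · obtain ⟨l, hl, rfl⟩ := exists_odd_mul_of_odd_div hk hm4 ho
      have hlk : l ∣ k := Nat.dvd_of_mul_dvd_mul_left hc0 hm4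
      have hlt : l < k := lt_of_le_of_ne (Nat.le_of_dvd hk0 hlk) (by rintro rfl; exact hm2 rfl)
      have := ih l hlt hl (by rintro rfl; simp at hm1) hm3
      push_cast
      obtain ⟨w, hw⟩ := this
      rw [hw]
      exact ⟨l * ZMod.χ₄ ((2 ^ s * k / (2 ^ s * l) : ℕ) : ZMod 4) * w, by ring⟩
    · rw [chi_eq_zero_of_not_odd ho]
      simp
  have hχ : (2 : ℤ) ^ r ∣ (k - ZMod.χ₄ (k : ZMod 4)) * β (2 ^ s) := by
    obtain ⟨w, hw⟩ := four_dvd_sub_chi_of_odd hk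
    rw [hw, mul_right_comm]
    exact h4.mul_right w
  have hmain : (2 : ℤ) ^ s * 2 ^ r ∣ 2 ^ s * (k * β (2 ^ s * k)) := by
    have h1 := (dvd_sub hE' hrest).add (mul_dvd_mul_left ((2 : ℤ) ^ s) hχ)
    obtain ⟨w, hw⟩ := h1
    refine ⟨w, ?_⟩
    rw [← hw, Nat.cast_one, map_one]
    push_cast
    ring
  have h2 : (2 : ℤ) ^ r ∣ k * β (2 ^ s * k) :=
    Int.dvd_of_mul_dvd_mul_left (by positivity) hmain
  refine IsCoprime.dvd_of_dvd_mul_left ?_ h2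
  refine IsCoprime.pow_left ?_
  rw [Int.isCoprime_iff_gcd_eq_one]
  simpa [Int.gcd] using Nat.coprime_two_left.2 hk

theorem dvd_of_dvd_weight {N : ℕ} {β G : ℕ → ℤ} {R : ℤ} (s : ℕ)
    (hG : ∀ x ∈ N.divisors,
      G x = ∑ m ∈ N.divisors with x ∣ m, ZMod.χ₄ ((m / x : ℕ) : ZMod 4) * β m)
    (hβ : ∀ k, Odd k → k ≠ 1 → 2 ^ s * k ∣ N → R ∣ β (2 ^ s * k))
    {k : ℕ} (hk : Odd k) (hk1 : k ≠ 1) (hkN : 2 ^ s * k ∈ N.divisors) : R ∣ G (2 ^ s * k) := by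
  rw [hG _ hkN]
  refine Finset.dvd_sum fun m hm => ?_
  simp only [Finset.mem_filter, Nat.mem_divisors] at hm
  by_cases ho : Odd (m / (2 ^ s * k))
  · obtain ⟨l, hl, rfl⟩ := odd_div_of_odd_mul_div hk hm.2 ho
    refine (hβ l hl ?_ hm.1.1).mul_left _
    rintro rfl
    exact hk1 (Nat.dvd_one.1 (Nat.dvd_of_mul_dvd_mul_left (by positivity) hm.2))
  · rw [chi_eq_zero_of_not_odd ho]
    simp

theorem dvd_sub_weight {N : ℕ} {β G : ℕ → ℤ} {R : ℤ} (s : ℕ)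
    (hG : ∀ x ∈ N.divisors,
      G x = ∑ m ∈ N.divisors with x ∣ m, ZMod.χ₄ ((m / x : ℕ) : ZMod 4) * β m)
    (hβ : ∀ k, Odd k → k ≠ 1 → 2 ^ s * k ∣ N → R ∣ β (2 ^ s * k))
    (hN : 2 ^ s ∈ N.divisors) : R ∣ G (2 ^ s) - β (2 ^ s) := by
  rw [hG _ hN, ← Finset.add_sum_erase _ _ (Finset.mem_filter.2 ⟨hN, dvd_refl (2 ^ s)⟩),
    Nat.div_self (by positivity), Nat.cast_one, map_one, one_mul, add_sub_cancel_left]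
  refine Finset.dvd_sum fun m hm => ?_
  simp only [Finset.mem_erase, Finset.mem_filter, Nat.mem_divisors] at hm
  by_cases ho : Odd (m / 2 ^ s)
  · obtain ⟨l, hl, rfl⟩ := odd_div_of_odd_mul_div (k := 1) odd_one (by simpa using hm.2.2)
      (by simpa using ho)
    refine (hβ l hl ?_ hm.2.1.1).mul_left _
    rintro rfl
    simp at hm
  · rw [chi_eq_zero_of_not_odd ho]
    simp

theorem weight_eq_zero {N : ℕ} {β G : ℕ → ℤ} (s : ℕ) (hN : N ≠ 0)
    (hG : ∀ x ∈ N.divisors,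
      G x = ∑ m ∈ N.divisors with x ∣ m, ZMod.χ₄ ((m / x : ℕ) : ZMod 4) * β m)
    (h0 : ∀ k, Odd k → k ≠ 1 → 2 ^ s * k ∣ N → G (2 ^ s * k) = 0) :
    ∀ k, Odd k → k ≠ 1 → 2 ^ s * k ∣ N → β (2 ^ s * k) = 0 := by
  suffices H : ∀ r k, N ≤ k + r → Odd k → k ≠ 1 → 2 ^ s * k ∣ N → β (2 ^ s * k) = 0 from
    fun k => H N k (by omega)
  intro r
  induction r using Nat.strong_induction_on with
  | _ r ih =>
  intro k hr hk hk1 hkN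
  have hc0 : 0 < 2 ^ s := by positivity
  have hmem : 2 ^ s * k ∈ N.divisors := by simp [hkN, hN]
  have hsum := h0 k hk hk1 hkN
  rw [hG _ hmem, ← Finset.add_sum_erase _ _ (Finset.mem_filter.2 ⟨hmem, dvd_refl _⟩),
    Nat.div_self (Nat.mul_pos hc0 hk.pos), Nat.cast_one, map_one, one_mul,
    Finset.sum_eq_zero, add_zero] at hsum
  · exact hsum
  intro m hm
  simp only [Finset.mem_erase, Finset.mem_filter, Nat.mem_divisors] at hm
  by_cases ho : Odd (m / (2 ^ s * k))
  · obtain ⟨l, hl, rfl⟩ := odd_div_of_odd_mul_div hk hm.2.2 ho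
    have hkl : k ∣ l := Nat.dvd_of_mul_dvd_mul_left hc0 hm.2.2
    have hlt : k < l := lt_of_le_of_ne (Nat.le_of_dvd hl.pos hkl) (by rintro rfl; exact hm.1 rfl)
    have hlN : l ≤ N := Nat.le_of_dvd (by omega) ((Dvd.intro_left _ rfl).trans hm.2.1.1)
    have := hk.pos
    rw [ih (N - l) (by omega) l (by omega) hl (by omega) hm.2.1.1, mul_zero]
  · rw [chi_eq_zero_of_not_odd ho, zero_mul]

theorem chiSum_of_weight_eq_zero {N : ℕ} {β : ℕ → ℤ} (s : ℕ)
    (hβ : ∀ k, Odd k → k ≠ 1 → 2 ^ s * k ∣ N → β (2 ^ s * k) = 0) (hN : 2 ^ s ∈ N.divisors)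
    {k : ℕ} (hk : Odd k) :
    chiSum N β (2 ^ s * k) = 2 ^ s * ZMod.χ₄ (k : ZMod 4) * β (2 ^ s) := by
  have hmem : 2 ^ s ∈ N.divisors.filter (fun m => m ∣ 2 ^ s * k) :=
    Finset.mem_filter.2 ⟨hN, Dvd.intro _ rfl⟩
  rw [chiSum, ← Finset.add_sum_erase _ _ hmem,
    Nat.mul_div_cancel_left _ (by positivity), Finset.sum_eq_zero, add_zero]
  · push_cast; rfl
  intro m hm
  simp only [Finset.mem_erase, Finset.mem_filter, Nat.mem_divisors] at hm
  by_cases ho : Odd (2 ^ s * k / m)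
  · obtain ⟨l, hl, rfl⟩ := exists_odd_mul_of_odd_div hk hm.2.2 ho
    rw [hβ l hl (by rintro rfl; simp at hm) hm.2.1.1, mul_zero]
  · rw [chi_eq_zero_of_not_odd ho, mul_zero, zero_mul]

theorem four_dvd_chiSum {N : ℕ} {β : ℕ → ℤ} {k : ℕ} (hk : 4 ∣ k) : 4 ∣ chiSum N β k := by
  refine Finset.dvd_sum fun m hm => ?_
  obtain ⟨-, o, rfl⟩ := Finset.mem_filter.1 hm
  rcases Nat.eq_zero_or_pos m with rfl | hm0
  · simp
  rw [Nat.mul_div_cancel_left _ hm0]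
  by_cases ho : Odd o
  · have : 2 ^ 2 ∣ m := (Nat.Coprime.pow_left 2 (Nat.coprime_two_left.2 ho)).dvd_of_dvd_mul_right hk
    rw [mul_assoc]
    exact Dvd.dvd.mul_right (by exact_mod_cast this) _
  · rw [chi_eq_zero_of_not_odd ho]
    simp

theorem odd_part_cases {k : ℕ} : Odd k ∨ (∃ l, Odd l ∧ k = 2 * l) ∨ 4 ∣ k := by
  rcases Nat.even_or_odd' k with ⟨l, rfl | rfl⟩
  · rcases Nat.even_or_odd' l with ⟨o, rfl | rfl⟩
    · exact Or.inr (Or.inr ⟨o, by ring⟩)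
    · exact Or.inr (Or.inl ⟨_, odd_two_mul_add_one o, rfl⟩)
  · exact Or.inl (odd_two_mul_add_one l)

theorem eq_zero_of_dvd_of_abs_le_one {a R : ℤ} (ha : |a| ≤ 1) (hR : 1 < R) (h : R ∣ a) : a = 0 :=
  Int.eq_zero_of_abs_lt_dvd h (ha.trans_lt hR)

theorem weights_of_chiSum_linear {N : ℕ} (hN : N ≠ 0) {β G : ℕ → ℤ}
    (hG : ∀ x ∈ N.divisors,
      G x = ∑ m ∈ N.divisors with x ∣ m, ZMod.χ₄ ((m / x : ℕ) : ZMod 4) * β m)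
    (hG1 : ∀ x, |G x| ≤ 1)
    {y : ℝ} (hy : ∀ k < 4 * N, ∃ z : ℤ, y * chiSum N β k = k + 4 * z) :
    2 ∣ N ∧ G 1 ≠ 0 ∧ G 2 ≠ 0 ∧ (∀ k, Odd k → k ≠ 1 → k ∣ N → G k = 0) ∧
      ∀ k, Odd k → k ≠ 1 → 2 * k ∣ N → G (2 * k) = 0 := by
  have hNpos : 0 < N := Nat.pos_of_ne_zero hN
  have hE1 : chiSum N β 1 = β 1 := by
    rw [chiSum, Finset.sum_eq_single_of_mem 1 (by simp [hN])]
    · simp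
    · intro m hm hm1
      exact absurd (Nat.dvd_one.1 (Finset.mem_filter.1 hm).2) hm1
  obtain ⟨z₁, hz₁⟩ := hy 1 (by omega)
  rw [hE1] at hz₁
  have hb : β 1 ≠ 0 := by
    intro h0
    rw [h0] at hz₁
    have : (0 : ℤ) = 1 + 4 * z₁ := by exact_mod_cast (by simpa using hz₁ : (0 : ℝ) = 1 + 4 * z₁)
    omega
  have hlin : ∀ k < 4 * N, 4 * β 1 ∣ (1 + 4 * z₁) * (chiSum N β k - β 1 * k) := by
    intro k hk
    obtain ⟨z, hz⟩ := hy k hk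
    refine ⟨z - k * z₁, ?_⟩
    have : (1 + 4 * (z₁ : ℝ)) * chiSum N β k = β 1 * (k + 4 * z) := by
      rw [← hz]
      push_cast at hz₁
      rw [← hz₁]
      ring
    have : (1 + 4 * z₁) * chiSum N β k = β 1 * (k + 4 * z) := by exact_mod_cast this
    linear_combination this
  obtain ⟨v, b', hb', hbv⟩ : ∃ v : ℕ, ∃ b' : ℤ, ¬ (2 : ℤ) ∣ b' ∧ β 1 = 2 ^ v * b' := by
    have hfin : FiniteMultiplicity (2 : ℤ) (β 1) :=
      Int.finiteMultiplicity_iff.2 ⟨by norm_num, hb⟩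
    obtain ⟨c, hc, hc'⟩ := hfin.exists_eq_pow_mul_and_not_dvd
    exact ⟨_, c, hc', hc⟩
  have hcong : ∀ k < 4 * N, (2 : ℤ) ^ (v + 2) ∣ chiSum N β k - β 1 * k := by
    intro k hk
    have h1 : (2 : ℤ) ^ (v + 2) ∣ (1 + 4 * z₁) * (chiSum N β k - β 1 * k) :=
      (Dvd.intro b' (by rw [hbv]; ring)).trans (hlin k hk)
    refine IsCoprime.dvd_of_dvd_mul_left (IsCoprime.pow_left ?_) h1
    exact ⟨-2 * z₁, 1, by ring⟩
  have hlt : ∀ k, k ∣ N → k < 4 * N := fun k hk => by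
    have := Nat.le_of_dvd hNpos hk
    omega
  have hβ1 : ∀ k, Odd k → k ≠ 1 → 2 ^ 0 * k ∣ N → (2 : ℤ) ^ (v + 2) ∣ β (2 ^ 0 * k) := by
    refine dvd_weight_of_chiSum hN 0 (v + 2) ⟨b', ?_⟩ fun k _ hkN => ?_
    · rw [pow_zero, hbv]
      ring
    · simp only [pow_zero, one_mul] at hkN ⊢
      have := hcong k (hlt k hkN)
      rwa [mul_comm (β 1)] at this
  have h4v : (1 : ℤ) < 2 ^ (v + 2) := one_lt_pow₀ (by norm_num) (by omega)
  have hGodd : ∀ k, Odd k → k ≠ 1 → k ∣ N → G k = 0 := by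
    intro k hk hk1 hkN
    have := dvd_of_dvd_weight 0 hG hβ1 hk hk1 (by simp [hkN, hN])
    rw [pow_zero, one_mul] at this
    exact eq_zero_of_dvd_of_abs_le_one (hG1 k) h4v this
  have hG1sub : (2 : ℤ) ^ (v + 2) ∣ G 1 - β 1 := by
    simpa using dvd_sub_weight 0 hG hβ1 (by simp [hN])
  have hGne : G 1 ≠ 0 := by
    intro h0
    rw [h0, zero_sub, dvd_neg, hbv, pow_add] at hG1sub
    have := Int.dvd_of_mul_dvd_mul_left (by positivity) hG1sub
    omega
  have hv : v = 0 := by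
    by_contra hv
    refine hGne (eq_zero_of_dvd_of_abs_le_one (hG1 1) (R := 2 ^ v) (one_lt_pow₀ (by norm_num) hv) ?_)
    have h1 : (2 : ℤ) ^ v ∣ G 1 - β 1 := (pow_dvd_pow 2 (by omega)).trans hG1sub
    have h2 : (2 : ℤ) ^ v ∣ β 1 := ⟨b', hbv⟩
    exact (dvd_sub_right h2).1 (by simpa using (dvd_neg.2 h1))
  subst hv
  rw [pow_zero, one_mul] at hbv
  rw [← hbv] at hb'
  norm_num at hcong
  have hc2 := hcong 2 (by omega)
  have hE2 : chiSum N β 2 = if 2 ∣ N then 2 * β 2 else 0 := by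
    have hz : ∀ m ∈ N.divisors.filter (fun m => m ∣ 2), m ≠ 2 →
        (m : ℤ) * ZMod.χ₄ ((2 / m : ℕ) : ZMod 4) * β m = 0 := by
      intro m hm hm2
      have h2 := (Finset.mem_filter.1 hm).2
      rcases (Nat.dvd_prime Nat.prime_two).1 h2 with rfl | rfl
      · simp
      · exact absurd rfl hm2
    split_ifs with h
    · rw [chiSum, Finset.sum_eq_single_of_mem 2 (by simp [h, hN]) hz]
      simp
    · refine Finset.sum_eq_zero fun m hm => hz m hm ?_
      rintro rfl
      exact h (Nat.dvd_of_mem_divisors (Finset.mem_filter.1 hm).1)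
  have h2N : 2 ∣ N := by
    by_contra h2N
    rw [if_neg h2N] at hE2
    omega
  rw [if_pos h2N] at hE2
  have hβ2 : ¬ (2 : ℤ) ∣ β 2 := by omega
  have hβ2' : ∀ k, Odd k → k ≠ 1 → 2 ^ 1 * k ∣ N → (2 : ℤ) ^ 1 ∣ β (2 ^ 1 * k) := by
    refine dvd_weight_of_chiSum hN 1 1 ⟨2 * β 2, by norm_num; ring⟩ fun k _ hkN => ?_
    have h1 := hcong _ (hlt _ hkN)
    norm_num at h1 ⊢
    have h2 : (2 : ℤ) ∣ k * (β 1 - β 2) := Dvd.dvd.mul_left (by omega) _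
    obtain ⟨w, hw⟩ := h2
    obtain ⟨u, hu⟩ := h1
    exact ⟨u + w, by linear_combination hu + 2 * hw⟩
  refine ⟨h2N, hGne, ?_, hGodd, ?_⟩
  · have := dvd_sub_weight 1 hG hβ2' (by simp [hN, h2N])
    norm_num at this
    omega
  · intro k hk hk1 hkN
    have := dvd_of_dvd_weight 1 hG hβ2' hk hk1 (by simp [hkN, hN])
    norm_num at this
    exact eq_zero_of_dvd_of_abs_le_one (hG1 _) one_lt_two this

theorem chiSum_linear_of_weights {N : ℕ} (hN : N ≠ 0) {β G : ℕ → ℤ}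
    (hG : ∀ x ∈ N.divisors,
      G x = ∑ m ∈ N.divisors with x ∣ m, ZMod.χ₄ ((m / x : ℕ) : ZMod 4) * β m)
    (hG1 : ∀ x, |G x| ≤ 1) (h2N : 2 ∣ N) (h1 : G 1 ≠ 0) (h2 : G 2 ≠ 0)
    (hodd : ∀ k, Odd k → k ≠ 1 → k ∣ N → G k = 0)
    (htwo : ∀ k, Odd k → k ≠ 1 → 2 * k ∣ N → G (2 * k) = 0) :
    ∃ y : ℝ, ∀ k : ℕ, ∃ z : ℤ, y * chiSum N β k = k + 4 * z := by
  have hβ1 := weight_eq_zero 0 hN hG (by simpa using hodd)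
  have hβ2 := weight_eq_zero 1 hN hG (by simpa using htwo)
  have hm1 : 2 ^ 0 ∈ N.divisors := by simp [hN]
  have hm2 : 2 ^ 1 ∈ N.divisors := by simp [hN, h2N]
  have e1 : G 1 = β 1 := by
    simpa [sub_eq_zero] using dvd_sub_weight (R := 0) 0 hG (by simpa using hβ1) hm1
  have e2 : G 2 = β 2 := by
    simpa [sub_eq_zero] using dvd_sub_weight (R := 0) 1 hG (by simpa using hβ2) hm2
  have a1 : β 1 = 1 ∨ β 1 = -1 := by
    have := abs_le.1 (hG1 1)
    omega
  have a2 : β 2 = 1 ∨ β 2 = -1 := by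
    have := abs_le.1 (hG1 2)
    omega
  refine ⟨(β 1 : ℤ), fun k => ?_⟩
  suffices H : (4 : ℤ) ∣ β 1 * chiSum N β k - k by
    obtain ⟨z, hz⟩ := H
    exact ⟨z, by exact_mod_cast (by linarith : β 1 * chiSum N β k = k + 4 * z)⟩
  rcases odd_part_cases (k := k) with hk | ⟨l, hl, rfl⟩ | hk
  · have hE := chiSum_of_weight_eq_zero 0 hβ1 hm1 hk
    simp only [pow_zero, one_mul] at hE
    rw [hE]
    have := four_dvd_sub_chi_of_odd hk
    rcases a1 with h | h <;> rw [h] <;> omega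
  · have hE := chiSum_of_weight_eq_zero 1 hβ2 hm2 hl
    simp only [pow_one] at hE
    rw [hE]
    have := four_dvd_sub_chi_of_odd hl
    have := Nat.odd_iff.1 hl
    push_cast
    rcases a1 with h | h <;> rcases a2 with h' | h' <;> rw [h, h'] <;> omega
  · have := (four_dvd_chiSum (N := N) (β := β) hk).mul_left (β 1)
    exact dvd_sub this (by exact_mod_cast hk)

theorem sum_chi_mul_pow (z : ℂ) (m : ℕ) :
    ∑ b ∈ Finset.range (4 * m), ((ZMod.χ₄ (b : ZMod 4) : ℤ) : ℂ) * z ^ b =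
      (z - z ^ 3) * ∑ c ∈ Finset.range m, (z ^ 4) ^ c := by
  induction m with
  | zero => simp
  | succ m ih =>
    have h0 : ZMod.χ₄ ((4 * m : ℕ) : ZMod 4) = 0 := chi_eq_zero_of_not_odd (by grind)
    have h1 : ZMod.χ₄ ((4 * m + 1 : ℕ) : ZMod 4) = 1 := ZMod.χ₄_nat_one_mod_four (by omega)
    have h2 : ZMod.χ₄ ((4 * m + 2 : ℕ) : ZMod 4) = 0 := chi_eq_zero_of_not_odd (by grind)
    have h3 : ZMod.χ₄ ((4 * m + 3 : ℕ) : ZMod 4) = -1 := ZMod.χ₄_nat_three_mod_four (by omega)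
    rw [show 4 * (m + 1) = 4 * m + 1 + 1 + 1 + 1 by ring, Finset.sum_range_succ,
      Finset.sum_range_succ, Finset.sum_range_succ, Finset.sum_range_succ, ih,
      Finset.sum_range_succ, h0, h1, h2, h3]
    push_cast
    ring

theorem I_pow_sub_I_pow_cube (k : ℕ) :
    Complex.I ^ k - (Complex.I ^ k) ^ 3 = 2 * Complex.I * (ZMod.χ₄ (k : ZMod 4) : ℤ) := by
  have h4 : k = 4 * (k / 4) + k % 4 := (Nat.div_add_mod k 4).symm
  have hI : Complex.I ^ k = Complex.I ^ (k % 4) := by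
    conv_lhs => rw [h4, pow_add, pow_mul, Complex.I_pow_four, one_pow, one_mul]
  have h3 : Complex.I ^ 3 = -Complex.I := Complex.I_pow_three
  rw [hI, ZMod.χ₄_nat_mod_four]
  have : k % 4 < 4 := Nat.mod_lt _ (by norm_num)
  interval_cases k % 4
  · simp
  · rw [ZMod.χ₄_nat_one_mod_four rfl, pow_one, h3]
    push_cast
    ring
  · rw [chi_eq_zero_of_not_odd (by decide), Complex.I_sq]
    norm_num
  · rw [ZMod.χ₄_nat_three_mod_four rfl, h3, neg_pow, h3]
    push_cast
    ring

/-- The Fourier transform of `χ₄` on `ℤ / 4m`. -/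
theorem sum_chi_mul_exp {m : ℕ} (hm : 0 < m) (k : ℕ) :
    ∑ b ∈ Finset.range (4 * m), ((ZMod.χ₄ (b : ZMod 4) : ℤ) : ℂ) *
        Complex.exp (2 * Real.pi * Complex.I * (b * k) / (4 * m)) =
      if m ∣ k then 2 * Complex.I * m * (ZMod.χ₄ ((k / m : ℕ) : ZMod 4) : ℤ) else 0 := by
  have hm0 : (m : ℂ) ≠ 0 := by exact_mod_cast hm.ne'
  set z : ℂ := Complex.exp (2 * Real.pi * Complex.I * k / (4 * m)) with hz
  have hpow : ∀ b : ℕ, Complex.exp (2 * Real.pi * Complex.I * (b * k) / (4 * m)) = z ^ b := by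
    intro b
    rw [hz, ← Complex.exp_nat_mul]
    congr 1
    ring
  simp only [hpow]
  rw [sum_chi_mul_pow]
  have hz4 : z ^ 4 = Complex.exp (2 * Real.pi * Complex.I * (k / m)) := by
    rw [hz, ← Complex.exp_nat_mul]
    congr 1
    push_cast
    field_simp
  split_ifs with h
  · obtain ⟨l, rfl⟩ := h
    have hzl : z = Complex.I ^ l := by
      rw [← Complex.exp_pi_div_two_mul_I, ← Complex.exp_nat_mul, hz]
      congr 1
      push_cast
      field_simp
      ring
    have h1 : (Complex.I ^ l) ^ 4 = 1 := by
      rw [← pow_mul, mul_comm, pow_mul, Complex.I_pow_four, one_pow]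
    rw [hzl, h1, I_pow_sub_I_pow_cube, Nat.mul_div_cancel_left _ hm]
    simp only [one_pow, Finset.sum_const, Finset.card_range, nsmul_eq_mul, mul_one]
    ring
  · have hne : z ^ 4 ≠ 1 := by
      rw [hz4, Ne, Complex.exp_eq_one_iff]
      rintro ⟨w, hw⟩
      have hpi : (2 * Real.pi * Complex.I : ℂ) ≠ 0 := Complex.two_pi_I_ne_zero
      rw [mul_comm (w : ℂ)] at hw
      have h2 := mul_left_cancel₀ hpi hw
      rw [div_eq_iff hm0] at h2
      have h3 : (k : ℤ) = w * m := by exact_mod_cast h2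
      exact h (Int.natCast_dvd_natCast.1 ⟨w, by rw [h3, mul_comm]⟩)
    have hone : (z ^ 4) ^ m = 1 := by
      rw [hz4, ← Complex.exp_nat_mul, Complex.exp_eq_one_iff]
      exact ⟨k, by push_cast; field_simp⟩
    rw [geom_sum_eq hne, hone, sub_self, zero_div, mul_zero]

section Circulant

variable {n : ℕ} [NeZero n]

/-- Perfect state transfer on a circulant Hermitian matrix, read off on the characters. -/
theorem exp_circulant_mulVec_single_iff (g : ZMod n → ℂ) (c : ℂ) (u v : ZMod n) (γ : ℂ) :
    (NormedSpace.exp (c • Matrix.of fun x y => g (y - x)) : Matrix (ZMod n) (ZMod n) ℂ).mulVec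
        (Pi.single u 1) = γ • (Pi.single v 1 : ZMod n → ℂ) ↔
      ∀ k : ZMod n, Complex.exp (c * ∑ a, ZMod.stdAddChar (a * k) * g a) *
        ZMod.stdAddChar (-(u * k)) = γ * ZMod.stdAddChar (-(v * k)) := by
  set W : Matrix (ZMod n) (ZMod n) ℂ := Matrix.of fun k j => ZMod.stdAddChar (-(j * k)) with hW
  set lam : ZMod n → ℂ := fun k => ∑ a, ZMod.stdAddChar (a * k) * g a with hlam
  set H : Matrix (ZMod n) (ZMod n) ℂ := Matrix.of fun x y => g (y - x) with hH
  have hWinj : ∀ x y : ZMod n → ℂ, W.mulVec x = W.mulVec y ↔ x = y := by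
    intro x y
    refine ⟨fun h => (ZMod.dft (E := ℂ) (N := n)).injective ?_, fun h => by rw [h]⟩
    exact h
  have hsemi : SemiconjBy W (c • H) (Matrix.diagonal fun k => c * lam k) := by
    ext k v
    rw [Matrix.diagonal_mul, Matrix.mul_apply, ← Equiv.sum_comp (Equiv.subLeft v)]
    simp only [hW, hH, hlam, Matrix.of_apply, Matrix.smul_apply, smul_eq_mul, Equiv.subLeft_apply,
      sub_sub_cancel]
    rw [mul_assoc, Finset.sum_mul, Finset.mul_sum]
    refine Finset.sum_congr rfl fun a _ => ?_
    rw [show -((v - a) * k) = a * k + -(v * k) by ring, AddChar.map_add_eq_mul]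
    ring
  have hexp : W * NormedSpace.exp (c • H) =
      Matrix.diagonal (fun k => Complex.exp (c * lam k)) * W := by
    have h1 : SemiconjBy W (NormedSpace.exp (c • H))
        (NormedSpace.exp (Matrix.diagonal fun k => c * lam k)) := by
      open scoped Matrix.Norms.Operator in exact hsemi.exp_right
    rw [h1.eq, Matrix.exp_diagonal]
    congr 2
    ext k
    rw [Pi.coe_exp, Complex.exp_eq_exp_ℂ]
  rw [← hWinj, Matrix.mulVec_mulVec, hexp, ← Matrix.mulVec_mulVec, Matrix.mulVec_smul,
    funext_iff]
  refine forall_congr' fun k => ?_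
  rw [Matrix.mulVec_diagonal, Matrix.mulVec_single_one, Pi.smul_apply, Matrix.mulVec_single_one]
  simp [hW, hlam]

/-- The first row of the Hermitian adjacency matrix. -/
def hermEntry (C : Finset ℕ) (a : ZMod n) : ℂ :=
  if a.val ∈ C then Complex.I else if (-a).val ∈ C then -Complex.I else 0

theorem hermMatrix_eq_of (C : Finset ℕ) :
    hermMatrix n C = Matrix.of fun u v => hermEntry C (v - u) := by
  ext u v
  simp [hermMatrix, hermEntry]

end Circulant

theorem stdAddChar_natCast {n : ℕ} [NeZero n] (j : ℕ) :
    ZMod.stdAddChar (j : ZMod n) = Complex.exp (2 * Real.pi * Complex.I * j / n) := by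
  have := ZMod.stdAddChar_coe (N := n) j
  push_cast at this
  exact this

theorem sum_zmod_eq_sum_range {n : ℕ} [NeZero n] (f : ZMod n → ℂ) :
    ∑ a, f a = ∑ a ∈ Finset.range n, f (a : ZMod n) := by
  refine Finset.sum_nbij' (fun a => a.val) (fun a => (a : ZMod n)) ?_ ?_ ?_ ?_ ?_
  · exact fun a _ => Finset.mem_range.2 a.val_lt
  · exact fun a _ => Finset.mem_univ _
  · exact fun a _ => ZMod.natCast_zmod_val a
  · exact fun a ha => ZMod.val_cast_of_lt (Finset.mem_range.1 ha)
  · exact fun a _ => by rw [ZMod.natCast_zmod_val a]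

/-- The value at `d` of `σ`, extended by zero outside `D`. -/
def signedIndicator (D : Finset ℕ) (σ : ℕ → ℤ) (d : ℕ) : ℤ := if d ∈ D then σ d else 0

theorem mem_symbol_iff {n : ℕ} {D : Finset ℕ} {σ : ℕ → ℤ} {a : ℕ} (ha : a < n) :
    a ∈ symbol n D σ ↔ a.gcd n ∈ D ∧
      (a / a.gcd n) % 4 = if σ (a.gcd n) = 1 then 1 else 3 := by
  simp only [symbol, Gsetr, Finset.mem_biUnion, Finset.mem_filter, Finset.mem_range]
  constructor
  · rintro ⟨d, hd, -, -, h, rfl⟩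
    exact ⟨hd, h⟩
  · rintro ⟨hd, h⟩
    exact ⟨_, hd, ha, Nat.gcd_dvd_left a n, h, rfl⟩

/-- The entries of the Hermitian adjacency matrix are given by `χ₄`. -/
theorem hermEntry_symbol {N : ℕ} [NeZero (4 * N)] {D : Finset ℕ}
    (hD : ∀ d ∈ D, d ∣ N) {σ : ℕ → ℤ} (hσ : ∀ d ∈ D, σ d = 1 ∨ σ d = -1) (a : ZMod (4 * N)) :
    hermEntry (symbol (4 * N) D σ) a = Complex.I * ((signedIndicator D σ (a.val.gcd (4 * N)) *
      ZMod.χ₄ ((a.val / a.val.gcd (4 * N) : ℕ) : ZMod 4) : ℤ) : ℂ) := by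
  have hN : 0 < N := by
    have := NeZero.pos (4 * N)
    omega
  have hgcd : (-a).val.gcd (4 * N) = a.val.gcd (4 * N) := by
    rw [ZMod.neg_val]
    split_ifs with h
    · simp [h]
    · rw [Nat.gcd_comm, Nat.gcd_self_sub_right a.val_lt.le, Nat.gcd_comm]
  simp only [hermEntry, mem_symbol_iff a.val_lt, mem_symbol_iff (-a).val_lt, hgcd, signedIndicator]
  set d := a.val.gcd (4 * N) with hd
  by_cases hdD : d ∈ D
  swap
  · simp [hdD]
  obtain ⟨e, he⟩ := hD d hdD
  have hd0 : 0 < d := Nat.gcd_pos_of_pos_right _ (NeZero.pos _)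
  have ha0 : a ≠ 0 := by
    rintro rfl
    have h1 : d = 4 * N := by simp [hd]
    have := Nat.le_of_dvd hN (hD d hdD)
    omega
  obtain ⟨q, hq⟩ : d ∣ a.val := Nat.gcd_dvd_left _ _
  have hneg : (-a).val / d = 4 * e - q := by
    rw [ZMod.neg_val, if_neg ha0, hq]
    have : 4 * N - d * q = d * (4 * e - q) := by
      rw [Nat.mul_sub]
      congr 1
      rw [he]
      ring
    rw [this, Nat.mul_div_cancel_left _ hd0]
  have hle : q ≤ 4 * e := by
    have h1 := a.val_lt
    rw [hq] at h1
    have h2 : d * q < d * (4 * e) := by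
      calc d * q < 4 * N := h1
        _ = d * (4 * e) := by rw [he]; ring
    exact (Nat.lt_of_mul_lt_mul_left h2).le
  rw [hneg, hq, Nat.mul_div_cancel_left _ hd0, ZMod.χ₄_nat_eq_if_mod_four]
  simp only [hdD, true_and, if_true]
  have hmod : q % 4 < 4 := Nat.mod_lt _ (by norm_num)
  rcases hσ d hdD with h | h <;> rw [h] <;>
    rcases (by omega : q % 4 = 0 ∨ q % 4 = 1 ∨ q % 4 = 2 ∨ q % 4 = 3) with h4 | h4 | h4 | h4
  all_goals
    have e1 : (4 * e - q) % 4 = (4 - q % 4) % 4 := by omega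
    have e2 : q % 2 = (q % 4) % 2 := by omega
    rw [e1, e2, h4]
    norm_num

theorem signedIndicator_gcd_mul_chi {N : ℕ} (hN : 0 < N) {D : Finset ℕ}
    (hD : ∀ d ∈ D, d ∣ N) {σ β : ℕ → ℤ}
    (hβ : ∀ x ∈ N.divisors, signedIndicator D σ (N / x) =
      ∑ m ∈ N.divisors with x ∣ m, ZMod.χ₄ ((m / x : ℕ) : ZMod 4) * β m) (a : ℕ) :
    signedIndicator D σ (a.gcd (4 * N)) * ZMod.χ₄ ((a / a.gcd (4 * N) : ℕ) : ZMod 4) =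
      ∑ m ∈ N.divisors,
        if N / m ∣ a then ZMod.χ₄ ((a / (N / m) : ℕ) : ZMod 4) * β m else 0 := by
  set d := a.gcd (4 * N) with hd
  have hd0 : 0 < d := Nat.gcd_pos_of_pos_right _ (by omega)
  obtain ⟨q, hq⟩ : d ∣ a := Nat.gcd_dvd_left _ _
  by_cases hdN : d ∣ N
  · obtain ⟨x, hx⟩ := hdN
    have hx0 : 0 < x := Nat.pos_of_ne_zero (by rintro rfl; omega)
    have hdx : d = N / x := by rw [hx, Nat.mul_div_cancel _ hx0]
    have hxN : x ∈ N.divisors := Nat.mem_divisors.2 ⟨⟨d, by rw [hx, mul_comm]⟩, hN.ne'⟩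
    rw [hdx, hβ x hxN, ← hdx, Finset.sum_mul, Finset.sum_filter]
    refine Finset.sum_congr rfl fun m hm => ?_
    obtain ⟨h, hh⟩ := Nat.dvd_of_mem_divisors hm
    have hm0 := Nat.pos_of_mem_divisors hm
    have hh0 : 0 < h := Nat.pos_of_ne_zero (by rintro rfl; omega)
    have hNm : N / m = h := by rw [hh, Nat.mul_div_cancel_left _ hm0]
    have hiff : x ∣ m ↔ N / m ∣ a := by
      rw [hNm]
      constructor
      · rintro ⟨k, rfl⟩
        refine Dvd.dvd.trans ⟨k, ?_⟩ (Nat.gcd_dvd_left a (4 * N))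
        exact Nat.eq_of_mul_eq_mul_right hx0 (by rw [← hd, ← hx, hh]; ring)
      · intro hha
        have : h ∣ d := Nat.dvd_gcd hha (Dvd.dvd.mul_left ⟨m, by rw [hh, mul_comm]⟩ 4)
        obtain ⟨k, hk⟩ := this
        refine ⟨k, Nat.eq_of_mul_eq_mul_right hh0 ?_⟩
        rw [← hh, hx, hk]
        ring
    by_cases hxm : x ∣ m
    · rw [if_pos hxm, if_pos (hiff.1 hxm), hNm]
      obtain ⟨k, rfl⟩ := hxm
      have hdk : d = h * k := Nat.eq_of_mul_eq_mul_right hx0 (by rw [← hx, hh]; ring)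
      rw [Nat.mul_div_cancel_left _ hx0, hq, Nat.mul_div_cancel_left _ hd0, hdk, mul_assoc h k q,
        Nat.mul_div_cancel_left _ hh0, Nat.cast_mul, map_mul]
      ring
    · rw [if_neg hxm, if_neg (fun h => hxm (hiff.2 h))]
  · rw [signedIndicator, if_neg (fun h => hdN (hD d h)), zero_mul]
    refine (Finset.sum_eq_zero fun m hm => ?_).symm
    obtain ⟨h, hh⟩ := Nat.dvd_of_mem_divisors hm
    have hm0 := Nat.pos_of_mem_divisors hm
    have hh0 : 0 < h := Nat.pos_of_ne_zero (by rintro rfl; omega)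
    have hNm : N / m = h := by rw [hh, Nat.mul_div_cancel_left _ hm0]
    rw [hNm]
    split_ifs with hha
    · rw [chi_eq_zero_of_not_odd, zero_mul]
      intro ho
      apply hdN
      obtain ⟨k, hk⟩ : h ∣ d := Nat.dvd_gcd hha (Dvd.dvd.mul_left ⟨m, by rw [hh, mul_comm]⟩ 4)
      rw [hq, hk, mul_assoc, Nat.mul_div_cancel_left _ hh0] at ho
      have hk2 : Odd k := (Nat.odd_mul.1 ho).1
      have h4 : h * k ∣ h * (4 * m) := by
        rw [← hk, show h * (4 * m) = 4 * N by rw [hh]; ring]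
        exact Nat.gcd_dvd_right _ _
      have hkm : k ∣ 4 * m := Nat.dvd_of_mul_dvd_mul_left hh0 h4
      have hcop : Nat.Coprime k (2 ^ 2) := Nat.Coprime.pow_right 2 (Nat.coprime_two_right.2 hk2)
      rw [hk, hh, mul_comm m]
      exact mul_dvd_mul_left h (hcop.dvd_of_dvd_mul_left hkm)
    · rfl

/-- The eigenvalues of the graph are `-2` times the integers `chiSum`. -/
theorem sum_stdAddChar_mul_symbol {N : ℕ} [NeZero (4 * N)] {D : Finset ℕ}
    (hD : ∀ d ∈ D, d ∣ N) {σ β : ℕ → ℤ} (hσ : ∀ d ∈ D, σ d = 1 ∨ σ d = -1)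
    (hβ : ∀ x ∈ N.divisors, signedIndicator D σ (N / x) =
      ∑ m ∈ N.divisors with x ∣ m, ZMod.χ₄ ((m / x : ℕ) : ZMod 4) * β m) (k : ZMod (4 * N)) :
    ∑ a : ZMod (4 * N), ZMod.stdAddChar (a * k) *
      hermEntry (symbol (4 * N) D σ) a = -2 * (chiSum N β k.val : ℂ) := by
  have hN : 0 < N := by
    have := NeZero.pos (4 * N)
    omega
  simp only [hermEntry_symbol hD hσ, signedIndicator_gcd_mul_chi hN hD hβ]
  rw [sum_zmod_eq_sum_range]
  have hterm : ∀ a ∈ Finset.range (4 * N), (ZMod.stdAddChar ((a : ZMod (4 * N)) * k) : ℂ) *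
      (Complex.I * ((∑ m ∈ N.divisors, if N / m ∣ (a : ZMod (4 * N)).val then
        ZMod.χ₄ (((a : ZMod (4 * N)).val / (N / m) : ℕ) : ZMod 4) * β m else 0 : ℤ) : ℂ)) =
      ∑ m ∈ N.divisors, Complex.I * β m * (if N / m ∣ a then
        ((ZMod.χ₄ ((a / (N / m) : ℕ) : ZMod 4) : ℤ) : ℂ) *
          Complex.exp (2 * Real.pi * Complex.I * (a * k.val) / (4 * N)) else 0) := by
    intro a ha
    have hk : (a : ZMod (4 * N)) * k = ((a * k.val : ℕ) : ZMod (4 * N)) := by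
      rw [Nat.cast_mul, ZMod.natCast_zmod_val k]
    rw [hk, stdAddChar_natCast, ZMod.val_cast_of_lt (Finset.mem_range.1 ha)]
    push_cast
    rw [Finset.mul_sum, Finset.mul_sum]
    refine Finset.sum_congr rfl fun m _ => ?_
    split_ifs
    · ring
    · simp
  rw [Finset.sum_congr rfl hterm, Finset.sum_comm, chiSum, Finset.sum_filter, Int.cast_sum,
    Finset.mul_sum]
  refine Finset.sum_congr rfl fun m hm => ?_
  obtain ⟨h, hh⟩ := Nat.dvd_of_mem_divisors hm
  have hm0 := Nat.pos_of_mem_divisors hm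
  have hh0 : 0 < h := Nat.pos_of_ne_zero (by rintro rfl; omega)
  have hNm : N / m = h := by rw [hh, Nat.mul_div_cancel_left _ hm0]
  have hsum : (∑ a ∈ Finset.range (4 * N), if N / m ∣ a then
        ((ZMod.χ₄ ((a / (N / m) : ℕ) : ZMod 4) : ℤ) : ℂ) *
          Complex.exp (2 * Real.pi * Complex.I * (a * k.val) / (4 * N)) else 0) =
      ∑ b ∈ Finset.range (4 * m), ((ZMod.χ₄ (b : ZMod 4) : ℤ) : ℂ) *
        Complex.exp (2 * Real.pi * Complex.I * (b * k.val) / (4 * m)) := by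
    rw [hNm, ← Finset.sum_filter]
    refine Finset.sum_nbij' (fun a => a / h) (fun b => h * b) ?_ ?_ ?_ ?_ ?_
    · intro a ha
      simp only [Finset.mem_filter, Finset.mem_range] at ha ⊢
      rw [Nat.div_lt_iff_lt_mul hh0]
      calc a < 4 * N := ha.1
        _ = 4 * m * h := by rw [hh]; ring
    · intro b hb
      simp only [Finset.mem_filter, Finset.mem_range] at hb ⊢
      refine ⟨?_, Dvd.intro _ rfl⟩
      calc h * b < h * (4 * m) := Nat.mul_lt_mul_of_pos_left hb hh0
        _ = 4 * N := by rw [hh]; ring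
    · intro a ha
      exact Nat.mul_div_cancel' (Finset.mem_filter.1 ha).2
    · intro b _
      exact Nat.mul_div_cancel_left _ hh0
    · intro a ha
      obtain ⟨b, rfl⟩ := (Finset.mem_filter.1 ha).2
      rw [Nat.mul_div_cancel_left _ hh0]
      have hh' : (h : ℂ) ≠ 0 := by exact_mod_cast hh0.ne'
      have hm' : (m : ℂ) ≠ 0 := by exact_mod_cast hm0.ne'
      have hNc : (N : ℂ) = m * h := by exact_mod_cast hh
      congr 2
      rw [hNc]
      push_cast
      field_simp
  rw [← Finset.mul_sum, hsum, sum_chi_mul_exp hm0]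
  split_ifs
  · push_cast
    linear_combination (2 * (β m : ℂ) * m * (ZMod.χ₄ ((k.val / m : ℕ) : ZMod 4) : ℤ)) *
      Complex.I_mul_I
  · simp

theorem chiSum_zero (N : ℕ) (β : ℕ → ℤ) : chiSum N β 0 = 0 := by
  refine Finset.sum_eq_zero fun m _ => ?_
  rw [Nat.zero_div, chi_eq_zero_of_not_odd (by decide), mul_zero, zero_mul]

section Transfer

variable {N : ℕ} [NeZero (4 * N)] {D : Finset ℕ} {σ β : ℕ → ℤ}

theorem hasPST_iff_chiSum (hD : ∀ d ∈ D, d ∣ N) (hσ : ∀ d ∈ D, σ d = 1 ∨ σ d = -1)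
    (hβ : ∀ x ∈ N.divisors, signedIndicator D σ (N / x) =
      ∑ m ∈ N.divisors with x ∣ m, ZMod.χ₄ ((m / x : ℕ) : ZMod 4) * β m) (u : ZMod (4 * N))
    (c : ℕ) :
    hasPST (4 * N) (symbol (4 * N) D σ) u (u + (c * N : ℕ)) ↔ ∃ (t : ℝ) (γ : ℂ), ‖γ‖ = 1 ∧
      ∀ k < 4 * N, Complex.exp (-(2 * t * chiSum N β k) * Complex.I) =
        γ * Complex.exp (-(Real.pi / 2 * (c * k)) * Complex.I) := by
  have hN : (N : ℂ) ≠ 0 := by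
    have := NeZero.ne (4 * N)
    exact_mod_cast (by omega : N ≠ 0)
  unfold hasPST transitionMatrix
  rw [hermMatrix_eq_of]
  simp only [exp_circulant_mulVec_single_iff, sum_stdAddChar_mul_symbol hD hσ hβ]
  refine exists_congr fun t => exists_congr fun γ => and_congr_right fun _ => ?_
  have key : ∀ k : ZMod (4 * N), (Complex.exp (Complex.I * t * (-2 * chiSum N β k.val)) *
      ZMod.stdAddChar (-(u * k)) = γ * ZMod.stdAddChar (-((u + ((c * N : ℕ) : ZMod (4 * N))) * k))) ↔
      Complex.exp (-(2 * t * chiSum N β k.val) * Complex.I) =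
        γ * Complex.exp (-(Real.pi / 2 * (c * k.val)) * Complex.I) := by
    intro k
    have hchar : (ZMod.stdAddChar (-(((c * N : ℕ) : ZMod (4 * N)) * k)) : ℂ) =
        Complex.exp (-(Real.pi / 2 * (c * k.val)) * Complex.I) := by
      have : ((c * N : ℕ) : ZMod (4 * N)) * k = ((c * N * k.val : ℕ) : ZMod (4 * N)) := by
        rw [Nat.cast_mul _ k.val, ZMod.natCast_zmod_val k]
      rw [this, AddChar.map_neg_eq_inv, stdAddChar_natCast, ← Complex.exp_neg]
      congr 1
      push_cast
      field_simp
      ring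
    have hne : (ZMod.stdAddChar (-(u * k)) : ℂ) ≠ 0 := by
      rw [ZMod.stdAddChar_apply]
      exact Circle.coe_ne_zero _
    rw [show -((u + ((c * N : ℕ) : ZMod (4 * N))) * k) =
      -(((c * N : ℕ) : ZMod (4 * N)) * k) + -(u * k) by ring,
      AddChar.map_add_eq_mul, hchar, ← mul_assoc γ, mul_left_inj' hne]
    rw [show Complex.I * t * (-2 * (chiSum N β k.val : ℂ)) =
      -(2 * t * chiSum N β k.val) * Complex.I by ring]
  constructor
  · intro h k hk
    have := (key k).1 (h k)
    rwa [ZMod.val_cast_of_lt hk] at this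
  · exact fun h k => (key k).2 (h k.val k.val_lt)

theorem hasPST_of_chiSum_linear (hD : ∀ d ∈ D, d ∣ N) (hσ : ∀ d ∈ D, σ d = 1 ∨ σ d = -1)
    (hβ : ∀ x ∈ N.divisors, signedIndicator D σ (N / x) =
      ∑ m ∈ N.divisors with x ∣ m, ZMod.χ₄ ((m / x : ℕ) : ZMod 4) * β m)
    {y : ℝ} (hy : ∀ k : ℕ, ∃ z : ℤ, y * chiSum N β k = k + 4 * z) (u : ZMod (4 * N)) (c : ℕ) :
    hasPST (4 * N) (symbol (4 * N) D σ) u (u + (c * N : ℕ)) := by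
  rw [hasPST_iff_chiSum hD hσ hβ]
  refine ⟨c * y * Real.pi / 4, 1, norm_one, fun k _ => ?_⟩
  obtain ⟨z, hz⟩ := hy k
  have hz' : (y : ℂ) * chiSum N β k = k + 4 * z := by exact_mod_cast congrArg (Complex.ofReal) hz
  rw [one_mul, Complex.exp_eq_exp_iff_exists_int]
  refine ⟨-(c * z), ?_⟩
  push_cast
  linear_combination (-(c * Real.pi / 2 * Complex.I) : ℂ) * hz'

theorem chiSum_linear_of_hasPST (hD : ∀ d ∈ D, d ∣ N) (hσ : ∀ d ∈ D, σ d = 1 ∨ σ d = -1)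
    (hβ : ∀ x ∈ N.divisors, signedIndicator D σ (N / x) =
      ∑ m ∈ N.divisors with x ∣ m, ZMod.χ₄ ((m / x : ℕ) : ZMod 4) * β m)
    (u : ZMod (4 * N)) (h : hasPST (4 * N) (symbol (4 * N) D σ) u (u + (1 * N : ℕ))) :
    ∃ y : ℝ, ∀ k < 4 * N, ∃ z : ℤ, y * chiSum N β k = k + 4 * z := by
  rw [hasPST_iff_chiSum hD hσ hβ] at h
  obtain ⟨t, γ, -, h⟩ := h
  have hγ : γ = 1 := by
    have h0 := h 0 (NeZero.pos _)
    rw [chiSum_zero] at h0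
    simpa using h0.symm
  refine ⟨4 * t / Real.pi, fun k hk => ?_⟩
  have hk := h k hk
  rw [hγ, one_mul, Complex.exp_eq_exp_iff_exists_int] at hk
  obtain ⟨z, hz⟩ := hk
  refine ⟨-z, ?_⟩
  have h1 : (-(2 * t * chiSum N β k) : ℂ) =
      -(Real.pi / 2 * ((1 : ℕ) * k)) + z * (2 * Real.pi) := by
    refine mul_right_cancel₀ Complex.I_ne_zero ?_
    rw [hz]
    ring
  have h2 : -(2 * t * chiSum N β k) = -(Real.pi / 2 * ((1 : ℕ) * k)) + z * (2 * Real.pi) := by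
    exact_mod_cast h1
  have hpi := Real.pi_ne_zero
  field_simp
  push_cast at h2 ⊢
  linarith

end Transfer

theorem padicValNat_two_four_mul {x r : ℕ} (hx : x ≠ 0) :
    padicValNat 2 (4 * x) = r + 2 ↔ padicValNat 2 x = r := by
  rw [show 4 * x = 2 * (2 * x) by ring, padicValNat.mul (by norm_num) (by omega),
    padicValNat.mul (by norm_num) hx, padicValNat.self (by norm_num)]
  omega

theorem padicValNat_two_eq_iff {x s : ℕ} (hx : x ≠ 0) :
    padicValNat 2 x = s ↔ ∃ k, Odd k ∧ x = 2 ^ s * k := by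
  constructor
  · rintro rfl
    obtain ⟨k, hk⟩ := pow_padicValNat_dvd (p := 2) (n := x)
    refine ⟨k, ?_, hk⟩
    by_contra ho
    obtain ⟨l, rfl⟩ := even_iff_two_dvd.1 (Nat.not_odd_iff_even.1 ho)
    exact pow_succ_padicValNat_not_dvd (p := 2) hx
      ⟨l, by rw [pow_succ, mul_assoc]; exact hk⟩
  · rintro ⟨k, hk, rfl⟩
    have hk0 : ¬ 2 ∣ k := fun h => Nat.not_even_iff_odd.2 hk (even_iff_two_dvd.2 h)
    rw [padicValNat.mul (by positivity) hk.pos.ne', padicValNat.prime_pow,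
      padicValNat.eq_zero_of_not_dvd hk0, add_zero]

theorem signedIndicator_ne_zero_iff {D : Finset ℕ} {σ : ℕ → ℤ}
    (hσ : ∀ d ∈ D, σ d = 1 ∨ σ d = -1) (d : ℕ) : signedIndicator D σ d ≠ 0 ↔ d ∈ D := by
  unfold signedIndicator
  split_ifs with h
  · rcases hσ d h with h' | h' <;> simp [h, h']
  · simp [h]

theorem abs_signedIndicator_le_one {D : Finset ℕ} {σ : ℕ → ℤ}
    (hσ : ∀ d ∈ D, σ d = 1 ∨ σ d = -1) (d : ℕ) : |signedIndicator D σ d| ≤ 1 := by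
  unfold signedIndicator
  split_ifs with h
  · rcases hσ d h with h' | h' <;> simp [h']
  · simp

/-- The divisors `d ∈ D` of `N` with `ν₂(N / d) = s` reduce to `N / 2 ^ s` exactly when the
indicator of `D` vanishes at all `N / (2 ^ s * k)` with `k ≠ 1` odd, but not at `k = 1`. -/
theorem filter_padicValNat_eq_singleton_iff {N s : ℕ} (hN : N ≠ 0) (hs : 2 ^ s ∣ N)
    {D : Finset ℕ} (hD : ∀ d ∈ D, d ∣ N) {σ : ℕ → ℤ} (hσ : ∀ d ∈ D, σ d = 1 ∨ σ d = -1) :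
    D.filter (fun d => padicValNat 2 (4 * N / d) = s + 2) = {N / 2 ^ s} ↔
      signedIndicator D σ (N / 2 ^ s) ≠ 0 ∧
        ∀ k, Odd k → k ≠ 1 → 2 ^ s * k ∣ N → signedIndicator D σ (N / (2 ^ s * k)) = 0 := by
  have hval : ∀ d, d ∣ N → (padicValNat 2 (4 * N / d) = s + 2 ↔
      ∃ k, Odd k ∧ N = d * (2 ^ s * k)) := by
    rintro d ⟨e, rfl⟩
    have hd : 0 < d := Nat.pos_of_ne_zero (left_ne_zero_of_mul hN)
    rw [show 4 * (d * e) = d * (4 * e) by ring, Nat.mul_div_cancel_left _ hd,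
      padicValNat_two_four_mul (right_ne_zero_of_mul hN),
      padicValNat_two_eq_iff (right_ne_zero_of_mul hN)]
    simp only [Nat.mul_right_inj hd.ne']
  have hdiv : ∀ d k, Odd k → N = d * (2 ^ s * k) → d = N / (2 ^ s * k) := by
    rintro d k hk h
    rw [h, Nat.mul_div_cancel _ (Nat.mul_pos (by positivity) hk.pos)]
  constructor
  · intro h
    have hmem := Finset.mem_singleton_self (N / 2 ^ s)
    rw [← h] at hmem
    refine ⟨(signedIndicator_ne_zero_iff hσ _).2 (Finset.mem_filter.1 hmem).1, ?_⟩
    intro k hk hk1 hkN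
    by_contra h0
    have hkD := (signedIndicator_ne_zero_iff hσ _).1 h0
    have h1 : N / (2 ^ s * k) ∈ D.filter (fun d => padicValNat 2 (4 * N / d) = s + 2) :=
      Finset.mem_filter.2 ⟨hkD, (hval _ (hD _ hkD)).2 ⟨k, hk, (Nat.div_mul_cancel hkN).symm⟩⟩
    rw [h, Finset.mem_singleton] at h1
    have h2 := Nat.div_mul_cancel hkN
    have h3 := Nat.div_mul_cancel hs
    rw [h1] at h2
    have h4 : 0 < N / 2 ^ s := Nat.div_pos (Nat.le_of_dvd (Nat.pos_of_ne_zero hN) hs)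
      (by positivity)
    have h5 := Nat.eq_of_mul_eq_mul_left h4 (h2.trans h3.symm)
    exact hk1 (Nat.eq_of_mul_eq_mul_left (show 0 < 2 ^ s by positivity) (by rw [h5, mul_one]))
  · rintro ⟨h1, h2⟩
    ext d
    rw [Finset.mem_filter, Finset.mem_singleton]
    constructor
    · rintro ⟨hdD, hd⟩
      obtain ⟨k, hk, hN'⟩ := (hval d (hD d hdD)).1 hd
      rcases eq_or_ne k 1 with rfl | hk1
      · simpa using hdiv d 1 hk hN'
      · have h0 := h2 k hk hk1 ⟨d, by rw [mul_comm]; exact hN'⟩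
        rw [← hdiv d k hk hN'] at h0
        exact absurd h0 ((signedIndicator_ne_zero_iff hσ d).2 hdD)
    · rintro rfl
      have hdD := (signedIndicator_ne_zero_iff hσ _).1 h1
      exact ⟨hdD, (hval _ (hD _ hdD)).2 ⟨1, odd_one, by rw [mul_one, Nat.div_mul_cancel hs]⟩⟩

theorem mst_iff_D2_D3 (n : ℕ) [NeZero n] (hn4 : 4 ∣ n)
    (D : Finset ℕ) (hD : ∀ d ∈ D, d ∣ n / 4)
    (σ : ℕ → ℤ) (hσ : ∀ d ∈ D, σ d = 1 ∨ σ d = -1) :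
    (∀ b : ZMod n, hasMST n (symbol n D σ)
        {b, b + (n / 4 : ℕ), b + (n / 2 : ℕ), b + (3 * n / 4 : ℕ)}) ↔
      (8 ∣ n ∧ D.filter (fun d => padicValNat 2 (n / d) = 2) = {n / 4} ∧
        D.filter (fun d => padicValNat 2 (n / d) = 3) = {n / 8}) := by
  obtain ⟨N, rfl⟩ := hn4
  have hN : N ≠ 0 := right_ne_zero_of_mul (NeZero.ne (4 * N))
  rw [Nat.mul_div_cancel_left N (by norm_num)] at hD
  rw [Nat.mul_div_cancel_left N (by norm_num), show 4 * N / 2 = 2 * N by omega,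
    show 3 * (4 * N) / 4 = 3 * N by omega, show 4 * N / 8 = N / 2 by omega]
  obtain ⟨β, hβ⟩ := exists_chi_weights N fun x => signedIndicator D σ (N / x)
  have hG1 : ∀ x, |(fun x => signedIndicator D σ (N / x)) x| ≤ 1 :=
    fun x => abs_signedIndicator_le_one hσ _
  have h2 := filter_padicValNat_eq_singleton_iff (s := 0) hN (one_dvd N) hD hσ
  simp only [zero_add, pow_zero, Nat.div_one, one_mul] at h2
  rw [h2]
  constructor
  · intro h
    have hne : (0 : ZMod (4 * N)) ≠ 0 + (N : ℕ) := by
      rw [zero_add, ne_comm, Ne, ZMod.natCast_eq_zero_iff]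
      intro hdvd
      have := Nat.le_of_dvd (Nat.pos_of_ne_zero hN) hdvd
      omega
    have hpst := h 0 0 (by simp) (0 + (N : ℕ)) (by simp) hne
    obtain ⟨y, hy⟩ := chiSum_linear_of_hasPST hD hσ hβ 0 (by simpa using hpst)
    obtain ⟨h2N, h1, h2', hodd, htwo⟩ := weights_of_chiSum_linear hN hβ hG1 hy
    refine ⟨by omega, ⟨by simpa using h1, hodd⟩, ?_⟩
    simpa using (filter_padicValNat_eq_singleton_iff (s := 1) hN (by simpa using h2N) hD hσ).2
      (by simpa using ⟨h2', htwo⟩)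
  · rintro ⟨h8, ⟨h1, hodd⟩, h3⟩
    have h2N : 2 ∣ N := by omega
    have h3' := (filter_padicValNat_eq_singleton_iff (s := 1) hN (by simpa using h2N) hD hσ).1
      (by simpa using h3)
    simp only [pow_one] at h3'
    obtain ⟨y, hy⟩ := chiSum_linear_of_weights hN hβ hG1 h2N (by simpa using h1) h3'.1 hodd h3'.2
    have hpst := hasPST_of_chiSum_linear hD hσ hβ hy
    have hcycle : (4 * N : ZMod (4 * N)) = 0 := by exact_mod_cast ZMod.natCast_self (4 * N)
    have hmul : ∀ b : ZMod (4 * N), ∀ u ∈ ({b, b + (N : ℕ), b + (2 * N : ℕ), b + (3 * N : ℕ)} :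
        Set (ZMod (4 * N))), ∃ c < 4, u = b + ((c * N : ℕ) : ZMod (4 * N)) := by
      rintro b u (rfl | rfl | rfl | rfl)
      · exact ⟨0, by norm_num, by simp⟩
      · exact ⟨1, by norm_num, by simp⟩
      · exact ⟨2, by norm_num, rfl⟩
      · exact ⟨3, by norm_num, rfl⟩
    intro b u hu v hv _
    obtain ⟨c, hc, rfl⟩ := hmul b u hu
    obtain ⟨c', -, rfl⟩ := hmul b v hv
    convert hpst (b + ((c * N : ℕ) : ZMod (4 * N))) (c' + (4 - c)) using 1
    push_cast [Nat.cast_sub hc.le]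
    linear_combination -hcycle

end
end

section
/- Let m be an odd positive integer, let n = 4m, and let q be a positive integer. If q is odd, then s_n(q) = (−1)^{(m−1)/2} · (−1)^{(q+1)/2} · 2 · c_m(q); if q is even, then s_n(q) = 0. -/
open Complex Finset

noncomputable section

/-- The additive character `x ↦ exp (2πi x / n)` depends only on `x` modulo `n`. -/
theorem exp_two_pi_div_eq_of_modEq {n : ℕ} (hn : n ≠ 0) {x y : ℤ} (h : x ≡ y [ZMOD n]) :
    Complex.exp (2 * Real.pi * Complex.I * x / n) =
      Complex.exp (2 * Real.pi * Complex.I * y / n) := by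
  obtain ⟨k, hk⟩ := h.symm.dvd
  rw [Complex.exp_eq_exp_iff_exists_int]
  refine ⟨k, ?_⟩
  have hn' : (n : ℂ) ≠ 0 := by exact_mod_cast hn
  have hx : (x : ℂ) = y + n * k := by
    have : x = y + n * k := by linarith
    exact_mod_cast this
  rw [hx]
  field_simp

/-- For `m` odd, `b ↦ 4b + m²` maps the reduced residues modulo `m` bijectively onto the
reduced residues modulo `4m` that are `1` modulo `4`. -/
theorem sum_Gsetr_four_mul {m : ℕ} (hm : Odd m) (f : ℕ → ℂ) :
    ∑ a ∈ Gsetr (4 * m) 1 1, f a =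
      ∑ b ∈ (Finset.Icc 1 m).filter (fun b => Nat.gcd b m = 1),
        f ((4 * b + m ^ 2) % (4 * m)) := by
  have hm0 : 0 < m := hm.pos
  have h4 : Nat.Coprime 4 m := by
    rw [show 4 = 2 ^ 2 from rfl]
    exact Nat.Coprime.pow_left 2 (Nat.coprime_two_left.2 hm)
  have hsq : m ^ 2 % 4 = 1 := by
    rcases Nat.odd_mod_four_iff.1 (Nat.odd_iff.1 hm) with h | h <;> simp [Nat.pow_mod, h]
  have hcop : ∀ b, Nat.gcd (4 * b + m ^ 2) (4 * m) = 1 ↔ Nat.gcd b m = 1 := by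
    intro b
    have h2 : Nat.Coprime (4 * b + m ^ 2) 4 := by
      rw [Nat.coprime_iff_gcd_eq_one, ← (Nat.mod_modEq _ _).gcd_eq]
      simp [Nat.add_mod, hsq]
    have h3 : Nat.Coprime (4 * b + m ^ 2) m ↔ Nat.Coprime b m := by
      rw [pow_two, Nat.coprime_add_mul_left_left, Nat.coprime_mul_iff_left]
      exact ⟨fun h => h.2, fun h => ⟨h4, h⟩⟩
    change Nat.Coprime _ _ ↔ Nat.Coprime _ _
    rw [Nat.coprime_mul_iff_right]
    exact ⟨fun h => h3.1 h.2, fun h => ⟨h2, h3.2 h⟩⟩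
  symm
  refine Finset.sum_bij (fun b _ => (4 * b + m ^ 2) % (4 * m)) ?_ ?_ ?_ (fun _ _ => rfl)
  · intro b hb
    simp only [Finset.mem_filter, Finset.mem_Icc] at hb
    simp only [Gsetr, Finset.mem_filter, Finset.mem_range, Nat.div_one]
    refine ⟨Nat.mod_lt _ (by omega), one_dvd _, ?_, ?_⟩
    · rw [Nat.mod_mul_right_mod]
      omega
    · rw [(Nat.mod_modEq _ _).gcd_eq]
      exact (hcop b).2 hb.2
  · intro b hb c hc h
    simp only [Finset.mem_filter, Finset.mem_Icc] at hb hc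
    have h1 : 4 * b ≡ 4 * c [MOD 4 * m] := Nat.ModEq.add_right_cancel' (m ^ 2) h
    have h2 : b ≡ c [MOD m] := Nat.ModEq.mul_left_cancel' (by norm_num) h1
    obtain ⟨b', rfl⟩ : ∃ b', b = b' + 1 := ⟨b - 1, by omega⟩
    obtain ⟨c', rfl⟩ : ∃ c', c = c' + 1 := ⟨c - 1, by omega⟩
    have h3 : b' ≡ c' [MOD m] := Nat.ModEq.add_right_cancel' 1 h2
    rw [h3.eq_of_lt_of_lt (by omega) (by omega)]
  · intro a ha
    simp only [Gsetr, Finset.mem_filter, Finset.mem_range, Nat.div_one] at ha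
    obtain ⟨k, hk⟩ : ∃ k, a + 3 * m ^ 2 = 4 * k := ⟨(a + 3 * m ^ 2) / 4, by omega⟩
    set b := (k + (m - 1)) % m + 1 with hb
    have hbk : b ≡ k [MOD m] := by
      have h : (k + (m - 1)) % m + 1 ≡ k + (m - 1) + 1 [MOD m] :=
        (Nat.mod_modEq _ _).add_right 1
      rw [show k + (m - 1) + 1 = k + m by omega] at h
      exact h.trans (by simp [Nat.ModEq])
    have hba : (4 * b + m ^ 2) % (4 * m) = a := by
      have h : 4 * b + m ^ 2 ≡ a [MOD 4 * m] := by
        refine ((hbk.mul_left' 4).add_right (m ^ 2)).trans ?_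
        rw [show 4 * k + m ^ 2 = a + 4 * m * m by rw [← hk]; ring]
        simp [Nat.ModEq]
      rw [h, Nat.mod_eq_of_lt ha.1]
    refine ⟨b, ?_, hba⟩
    simp only [Finset.mem_filter, Finset.mem_Icc]
    refine ⟨⟨by omega, ?_⟩, ?_⟩
    · have := Nat.mod_lt (k + (m - 1)) hm0
      omega
    · rw [← hcop, ← (Nat.mod_modEq _ _).gcd_eq, hba]
      exact ha.2.2.2

/-- Ramanujan's sum is even in its argument. -/
theorem ramanujanSum_eq_sum_neg {m : ℕ} (hm0 : 0 < m) (q : ℕ) :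
    ramanujanSum m q = ∑ b ∈ (Finset.Icc 1 m).filter (fun b => Nat.gcd b m = 1),
      Complex.exp (-(2 * Real.pi * Complex.I * b * q / m)) := by
  have hself : ∀ b ∈ (Finset.Icc 1 m).filter (fun b => Nat.gcd b m = 1),
      m - b % m ∈ (Finset.Icc 1 m).filter (fun b => Nat.gcd b m = 1) := by
    intro b hb
    simp only [Finset.mem_filter, Finset.mem_Icc] at hb ⊢
    have hlt := Nat.mod_lt b hm0
    refine ⟨by omega, ?_⟩
    rw [Nat.gcd_comm, Nat.gcd_self_sub_right hlt.le, Nat.gcd_comm, (Nat.mod_modEq _ _).gcd_eq]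
    exact hb.2
  have hinv : ∀ b ∈ (Finset.Icc 1 m).filter (fun b => Nat.gcd b m = 1),
      m - (m - b % m) % m = b := by
    intro b hb
    simp only [Finset.mem_filter, Finset.mem_Icc] at hb
    rcases hb.1.2.eq_or_lt with rfl | h
    · simp
    · rw [Nat.mod_eq_of_lt h, Nat.mod_eq_of_lt (by omega : m - b < m)]
      omega
  refine Finset.sum_nbij' (fun b => m - b % m) (fun b => m - b % m) hself hself hinv hinv ?_
  intro b _
  have hlt := Nat.mod_lt b hm0
  have h : (b * q : ℤ) ≡ -((m - b % m : ℕ) * q : ℤ) [ZMOD m] := by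
    rw [← neg_mul]
    refine Int.ModEq.mul_right _ ?_
    rw [Nat.cast_sub hlt.le, Int.modEq_iff_dvd]
    refine ⟨-1 - (b / m : ℤ), ?_⟩
    push_cast
    have := Int.emod_add_mul_ediv (b : ℤ) m
    linear_combination this
  have := exp_two_pi_div_eq_of_modEq hm0.ne' h
  push_cast at this
  convert this using 2 <;> ring

theorem sum_Gsetr_exp {m : ℕ} (hm : Odd m) (q : ℕ) :
    ∑ a ∈ Gsetr (4 * m) 1 1, Complex.exp (2 * Real.pi * Complex.I * a * q / (4 * m : ℕ)) =
      Complex.I ^ (m * q) * ramanujanSum m q := by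
  have hmC : (m : ℂ) ≠ 0 := by exact_mod_cast hm.pos.ne'
  rw [sum_Gsetr_four_mul hm, ramanujanSum, Finset.mul_sum]
  refine Finset.sum_congr rfl fun b _ => ?_
  have h : (((4 * b + m ^ 2) % (4 * m) : ℕ) * q : ℤ) ≡ (4 * b + m ^ 2) * q [ZMOD (4 * m : ℕ)] := by
    refine Int.ModEq.mul_right _ ?_
    exact_mod_cast Int.natCast_modEq_iff.2 (Nat.mod_modEq (4 * b + m ^ 2) (4 * m))
  have h' := exp_two_pi_div_eq_of_modEq (by have := hm.pos; omega) h
  rw [Int.cast_mul, Int.cast_natCast, Int.cast_natCast, ← mul_assoc] at h'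
  have hI : Complex.I = Complex.exp (Real.pi / 2 * Complex.I) :=
    Complex.exp_pi_div_two_mul_I.symm
  rw [h']
  nth_rewrite 2 [hI]
  rw [← Complex.exp_nat_mul, ← Complex.exp_add]
  congr 1
  push_cast
  field_simp
  ring

theorem sum_Gsetr_exp_neg {m : ℕ} (hm : Odd m) (q : ℕ) :
    ∑ a ∈ Gsetr (4 * m) 1 1, Complex.exp (-(2 * Real.pi * Complex.I * a * q / (4 * m : ℕ))) =
      (-Complex.I) ^ (m * q) * ramanujanSum m q := by
  have h := congrArg (starRingEnd ℂ) (sum_Gsetr_exp hm q)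
  have hreal : (starRingEnd ℂ) (ramanujanSum m q) = ramanujanSum m q := by
    conv_rhs => rw [ramanujanSum_eq_sum_neg hm.pos]
    rw [ramanujanSum, map_sum]
    refine Finset.sum_congr rfl fun b _ => ?_
    rw [← Complex.exp_conj]
    congr 1
    simp [neg_div, Complex.conj_ofNat]
  rw [map_sum, map_mul, map_pow, Complex.conj_I, hreal] at h
  rw [← h]
  refine Finset.sum_congr rfl fun a _ => ?_
  rw [← Complex.exp_conj]
  congr 1
  simp [neg_div, Complex.conj_ofNat]

theorem sineSum_four_mul (m : ℕ) (hm : Odd m) (hm0 : 0 < m) (q : ℕ) (hq : 0 < q) :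
    (Odd q → sineSum (4 * m) q =
      (-1 : ℂ) ^ ((m - 1) / 2) * (-1 : ℂ) ^ ((q + 1) / 2) * 2 * ramanujanSum m q) ∧
    (Even q → sineSum (4 * m) q = 0) := by
  have hs : sineSum (4 * m) q =
      Complex.I * (Complex.I ^ (m * q) - (-Complex.I) ^ (m * q)) * ramanujanSum m q := by
    rw [sineSum, Finset.sum_sub_distrib, sum_Gsetr_exp hm, sum_Gsetr_exp_neg hm]
    ring
  refine ⟨fun hq => ?_, fun hq => ?_⟩
  · rw [hs, (hm.mul hq).neg_pow]
    obtain ⟨k, rfl⟩ := hm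
    obtain ⟨l, rfl⟩ := hq
    rw [show (2 * k + 1 - 1) / 2 = k by omega, show (2 * l + 1 + 1) / 2 = l + 1 by omega,
      show (2 * k + 1) * (2 * l + 1) = 4 * (k * l) + 2 * k + 2 * l + 1 by ring]
    simp only [pow_add, pow_mul, Complex.I_pow_four, Complex.I_sq, one_pow, pow_one]
    linear_combination (2 * (-1 : ℂ) ^ k * (-1) ^ l * ramanujanSum (2 * k + 1) (2 * l + 1)) *
      Complex.I_sq
  · rw [hs, (hq.mul_left m).neg_pow]
    ring

end
end

section
/- Let m be an odd positive integer, let t ≥ 2 be an integer, let n = 2^t m, and let q be a positive integer divisible by 2^{t−2}. Then s_n(q) = 2^{t−2} · s_{4m}(q / 2^{t−2}). -/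
open Complex Finset

noncomputable section

theorem sum_range_mul_of_periodic {M : Type*} [AddCommMonoid M] {g : ℕ → M} {N : ℕ}
    (hg : Function.Periodic g N) (k : ℕ) :
    ∑ a ∈ Finset.range (k * N), g a = k • ∑ a ∈ Finset.range N, g a := by
  induction k with
  | zero => simp
  | succ k ih =>
    rw [Nat.succ_mul, Finset.sum_range_add, ih, succ_nsmul]
    congr 1
    refine Finset.sum_congr rfl fun a _ => ?_
    rw [add_comm, ← smul_eq_mul]
    exact hg.nsmul k a

theorem Gsetr_one_one_two_pow_mul (s N : ℕ) :
    Gsetr (2 ^ s * N) 1 1 =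
      (Finset.range (2 ^ s * N)).filter (fun a => a % 4 = 1 ∧ Nat.gcd a N = 1) := by
  refine Finset.filter_congr fun a _ => ?_
  simp only [one_dvd, Nat.div_one, true_and]
  refine and_congr_right fun ha => ?_
  have h2 : Nat.Coprime a (2 ^ s) :=
    Nat.Coprime.pow_right s (Nat.coprime_two_right.mpr (Nat.odd_iff.mpr (by omega)))
  exact Nat.coprime_mul_iff_right.trans (and_iff_right h2)

theorem exp_two_pi_mul_div_periodic {N : ℕ} (hN : N ≠ 0) (r : ℕ) :
    Function.Periodic
      (fun a : ℕ => Complex.exp (2 * Real.pi * Complex.I * a * r / N)) N := by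
  intro a
  have hN' : (N : ℂ) ≠ 0 := Nat.cast_ne_zero.mpr hN
  have h : (2 * Real.pi * Complex.I * ((a + N : ℕ) : ℂ) * r / N : ℂ)
      = 2 * Real.pi * Complex.I * a * r / N + r * (2 * Real.pi * Complex.I) := by
    push_cast
    field_simp
  simp only [h]
  exact (Complex.exp_periodic.nat_mul r) _

theorem sineSum_two_pow_mul_mul (s : ℕ) {N : ℕ} (hN : N ≠ 0) (h4 : 4 ∣ N) (r : ℕ) :
    sineSum (2 ^ s * N) (2 ^ s * r) = 2 ^ s * sineSum N r := by
  set f : ℕ → ℂ := fun a => Complex.exp (2 * Real.pi * Complex.I * a * r / N) -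
    Complex.exp (-(2 * Real.pi * Complex.I * a * r / N)) with hf
  have hper : Function.Periodic
      (fun a => if a % 4 = 1 ∧ Nat.gcd a N = 1 then f a else 0) N := by
    intro a
    have h1 : (a + N) % 4 = a % 4 := by omega
    have h2 := exp_two_pi_mul_div_periodic hN r a
    simp only [hf, h1, Nat.gcd_add_self_left, Complex.exp_neg] at h2 ⊢
    rw [h2]
  have hG : Gsetr N 1 1 =
      (Finset.range N).filter (fun a => a % 4 = 1 ∧ Nat.gcd a N = 1) := by
    simpa using Gsetr_one_one_two_pow_mul 0 N
  have harg (a : ℕ) : (2 * Real.pi * Complex.I * a * ((2 ^ s * r : ℕ) : ℂ) /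
      ((2 ^ s * N : ℕ) : ℂ)) = 2 * Real.pi * Complex.I * a * r / N := by
    have hN' : (N : ℂ) ≠ 0 := Nat.cast_ne_zero.mpr hN
    push_cast
    field_simp
  have hsum := sum_range_mul_of_periodic hper (2 ^ s)
  rw [← Finset.sum_filter, ← Finset.sum_filter, nsmul_eq_mul] at hsum
  push_cast at hsum
  simp only [sineSum, harg, Gsetr_one_one_two_pow_mul, hG]
  rw [hsum]
  ring

theorem sineSum_two_pow_mul (m t : ℕ) (hm : Odd m) (hm0 : 0 < m) (ht : 2 ≤ t)
    (q : ℕ) (hq : 0 < q) (hdvd : 2 ^ (t - 2) ∣ q) :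
    sineSum (2 ^ t * m) q = (2 ^ (t - 2) : ℂ) * sineSum (4 * m) (q / 2 ^ (t - 2)) := by
  obtain ⟨s, rfl⟩ := Nat.exists_eq_add_of_le' ht
  rw [Nat.add_sub_cancel] at hdvd ⊢
  obtain ⟨r, rfl⟩ := hdvd
  rw [Nat.mul_div_cancel_left r (by positivity), pow_add, mul_assoc]
  exact sineSum_two_pow_mul_mul s (by omega) (dvd_mul_right 4 m) r

end
end

section
/- Let m be an odd positive integer, let t ≥ 2 be an integer, let n = 2^t m, and let q be a positive integer. If q = 2^{t−2} q' for an odd positive integer q', then s_n(q) = (−1)^{(m−1)/2} · (−1)^{(q'+1)/2} · 2^{t−1} · c_m(q'); otherwise (i.e. if 2^{t−2} does not divide q, or q/2^{t−2} is even), s_n(q) = 0. -/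
open Complex Finset

noncomputable section

lemma coprime_two_pow_mul_iff {m t a : ℕ} (ha : a % 4 = 1) :
    Nat.gcd a (2 ^ t * m) = 1 ↔ Nat.Coprime a m := by
  have h2 : Nat.Coprime a (2 ^ t) :=
    Nat.Coprime.pow_right t (Nat.coprime_two_right.2 (Nat.odd_iff.2 (by omega)))
  rw [← Nat.coprime_iff_gcd_eq_one, Nat.coprime_mul_iff_right]
  exact and_iff_right h2

lemma mem_Gsetr_one_one {m t a : ℕ} :
    a ∈ Gsetr (2 ^ t * m) 1 1 ↔ a < 2 ^ t * m ∧ a % 4 = 1 ∧ Nat.Coprime a m := by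
  simp only [Gsetr, Finset.mem_filter, Finset.mem_range, one_dvd, Nat.div_one, true_and]
  exact and_congr_right fun _ => and_congr_right fun h => coprime_two_pow_mul_iff h

lemma sq_mod_four_of_odd {m : ℕ} (hm : Odd m) : m ^ 2 % 4 = 1 := by
  obtain ⟨k, rfl⟩ := hm
  have : (2 * k + 1) ^ 2 = 4 * (k ^ 2 + k) + 1 := by ring
  omega

/-- Summation over `G_n^1(1)`, `n = 2 ^ (s + 2) * m`, through the parametrisation
`a ≡ 4 (b + m j) + m ^ 2 (mod n)`. -/
lemma sum_Gsetr_one_one {m s : ℕ} (hm : Odd m) (f : ℕ → ℂ)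
    (hf : ∀ a, f (a % (2 ^ (s + 2) * m)) = f a) :
    ∑ a ∈ Gsetr (2 ^ (s + 2) * m) 1 1, f a =
      ∑ b ∈ (Finset.Icc 1 m).filter (fun b => Nat.gcd b m = 1), ∑ j ∈ Finset.range (2 ^ s),
        f (4 * (b + m * j) + m ^ 2) := by
  have hm0 : 0 < m := hm.pos
  have hT : 0 < 2 ^ s := by positivity
  have hn : 2 ^ (s + 2) * m = 4 * (2 ^ s * m) := by ring
  have hN : 0 < 2 ^ s * m := by positivity
  have hsq := sq_mod_four_of_odd hm
  have hcop : ∀ b k : ℕ, Nat.Coprime (4 * (b + m * k) + m ^ 2) m ↔ Nat.gcd b m = 1 := by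
    intro b k
    have h4 : Nat.Coprime 4 m := by
      have : Nat.Coprime (2 ^ 2) m := Nat.Coprime.pow_left 2 (Nat.coprime_two_left.2 hm)
      simpa using this
    have : 4 * (b + m * k) + m ^ 2 = 4 * b + (4 * k + m) * m := by ring
    rw [this, Nat.coprime_add_mul_right_left, Nat.coprime_mul_iff_left]
    exact and_iff_right h4
  have hmodgcd : ∀ a : ℕ, Nat.gcd (a % (2 ^ (s + 2) * m)) m = Nat.gcd a m := fun a =>
    ((Nat.mod_modEq a _).of_dvd (Dvd.intro_left _ rfl)).gcd_eq
  rw [← Finset.sum_product']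
  symm
  refine Finset.sum_bij (fun p _ => (4 * (p.1 + m * p.2) + m ^ 2) % (2 ^ (s + 2) * m)) ?_ ?_ ?_ ?_
  · rintro ⟨b, j⟩ h
    simp only [Finset.mem_product, Finset.mem_filter, Finset.mem_Icc, Finset.mem_range] at h
    refine mem_Gsetr_one_one.2 ⟨Nat.mod_lt _ (by positivity), ?_, ?_⟩
    · rw [hn, Nat.mod_mul_right_mod]
      omega
    · exact (hmodgcd _).trans ((hcop b j).2 h.1.2)
  · rintro ⟨b, j⟩ h ⟨b', j'⟩ h' heq
    simp only [Finset.mem_product, Finset.mem_filter, Finset.mem_Icc, Finset.mem_range] at h h' heq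
    rw [hn] at heq
    have h1 : 4 * (b + m * j) ≡ 4 * (b' + m * j') [MOD 4 * (2 ^ s * m)] :=
      Nat.ModEq.add_right_cancel' _ heq
    have h2 : b + m * j ≡ b' + m * j' [MOD 2 ^ s * m] :=
      Nat.ModEq.mul_left_cancel' (by norm_num) h1
    obtain ⟨c, rfl⟩ : ∃ c, b = c + 1 := ⟨b - 1, by omega⟩
    obtain ⟨c', rfl⟩ : ∃ c', b' = c' + 1 := ⟨b' - 1, by omega⟩
    have h3 : c + m * j ≡ c' + m * j' [MOD 2 ^ s * m] := by
      refine Nat.ModEq.add_right_cancel' 1 ?_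
      convert h2 using 1 <;> ring
    have bd : ∀ c j : ℕ, c < m → j < 2 ^ s → c + m * j < 2 ^ s * m := by
      intro c j hc hj
      nlinarith [Nat.mul_le_mul_left m (Nat.succ_le_of_lt hj)]
    have h4 : c + m * j = c' + m * j' :=
      Nat.ModEq.eq_of_lt_of_lt h3 (bd _ _ (by omega) h.2) (bd _ _ (by omega) h'.2)
    have h5 : c = c' := by
      have := congrArg (· % m) h4
      simpa [Nat.mod_eq_of_lt (show c < m by omega),
        Nat.mod_eq_of_lt (show c' < m by omega)] using this
    subst h5
    have h6 : j = j' := Nat.eq_of_mul_eq_mul_left hm0 (by omega)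
    rw [h6]
  · intro a ha
    obtain ⟨ha1, ha2, ha3⟩ := mem_Gsetr_one_one.1 ha
    have hdvd : (4 : ℤ) ∣ (a : ℤ) - (m : ℤ) ^ 2 - 4 := by
      have : ((m ^ 2 : ℕ) : ℤ) = (m : ℤ) ^ 2 := by push_cast; rfl
      omega
    obtain ⟨z, hz⟩ := hdvd
    have hNz : (0 : ℤ) < ((2 ^ s * m : ℕ) : ℤ) := by exact_mod_cast hN
    obtain ⟨k, hk⟩ := Int.eq_ofNat_of_zero_le (Int.emod_nonneg z hNz.ne')
    have hkN : k < 2 ^ s * m := by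
      have := Int.emod_lt_of_pos z hNz
      rw [hk] at this
      exact_mod_cast this
    have hkz : (k : ℤ) ≡ z [ZMOD ((2 ^ s * m : ℕ) : ℤ)] := by
      rw [← hk]; exact Int.mod_modEq _ _
    have hkm : k % m + 1 + m * (k / m) = k + 1 := by
      have := Nat.mod_add_div k m
      omega
    have hmod : (4 * (k + 1) + m ^ 2) % (2 ^ (s + 2) * m) = a := by
      have h1 : (4 * (k + 1) + m ^ 2) ≡ a [MOD 2 ^ (s + 2) * m] := by
        rw [← Int.natCast_modEq_iff, hn]
        push_cast
        have h2 := (hkz.mul_left' (c := 4)).add_right ((m : ℤ) ^ 2 + 4)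
        push_cast at h2
        convert h2 using 1
        · ring
        · linarith
      rw [h1, Nat.mod_eq_of_lt ha1]
    refine ⟨(k % m + 1, k / m), ?_, ?_⟩
    · simp only [Finset.mem_product, Finset.mem_filter, Finset.mem_Icc, Finset.mem_range]
      refine ⟨⟨⟨by omega, Nat.mod_lt _ hm0⟩, ?_⟩, ?_⟩
      · rw [← hcop _ (k / m), hkm, Nat.coprime_iff_gcd_eq_one, ← hmodgcd, hmod]
        exact ha3
      · exact Nat.div_lt_of_lt_mul (by rwa [mul_comm])
    · simp only [hkm, hmod]
  · rintro ⟨b, j⟩ _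
    exact (hf _).symm

lemma exp_two_pi_mod {n : ℕ} (hn : 0 < n) (q : ℤ) (a : ℕ) :
    Complex.exp (2 * Real.pi * Complex.I * (a % n : ℕ) * q / n) =
      Complex.exp (2 * Real.pi * Complex.I * a * q / n) := by
  rw [Complex.exp_eq_exp_iff_exists_int]
  refine ⟨-(((a / n : ℕ) : ℤ) * q), ?_⟩
  have hn' : (n : ℂ) ≠ 0 := by exact_mod_cast hn.ne'
  have h : (a : ℂ) = (a % n : ℕ) + n * (a / n : ℕ) := by exact_mod_cast (Nat.mod_add_div a n).symm
  rw [h, Int.cast_neg, Int.cast_mul, Int.cast_natCast]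
  field_simp
  ring

lemma sum_exp_Gsetr_one_one {m s : ℕ} (hm : Odd m) (q : ℤ) :
    ∑ a ∈ Gsetr (2 ^ (s + 2) * m) 1 1,
        Complex.exp (2 * Real.pi * Complex.I * a * q / (2 ^ (s + 2) * m : ℕ)) =
      (∑ b ∈ (Finset.Icc 1 m).filter (fun b => Nat.gcd b m = 1),
        Complex.exp (2 * Real.pi * Complex.I * (4 * b + m ^ 2) * q / (2 ^ (s + 2) * m : ℕ))) *
      ∑ j ∈ Finset.range (2 ^ s), Complex.exp (2 * Real.pi * Complex.I * q / 2 ^ s) ^ j := by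
  have hm0 : (m : ℂ) ≠ 0 := by exact_mod_cast hm.pos.ne'
  have hn : 0 < 2 ^ (s + 2) * m := Nat.mul_pos (by positivity) hm.pos
  rw [sum_Gsetr_one_one hm _ (exp_two_pi_mod hn q), Finset.sum_mul_sum]
  refine Finset.sum_congr rfl fun b _ => Finset.sum_congr rfl fun j _ => ?_
  rw [← Complex.exp_nat_mul, ← Complex.exp_add]
  congr 1
  push_cast
  field_simp
  ring

lemma geom_sum_exp_eq_zero {T : ℕ} (hT : 0 < T) {q : ℤ} (h : ¬ (T : ℤ) ∣ q) :
    ∑ j ∈ Finset.range T, Complex.exp (2 * Real.pi * Complex.I * q / T) ^ j = 0 := by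
  have hT' : (T : ℂ) ≠ 0 := by exact_mod_cast hT.ne'
  have h1 : Complex.exp (2 * Real.pi * Complex.I * q / T) ≠ 1 := by
    rw [Ne, Complex.exp_eq_one_iff]
    rintro ⟨k, hk⟩
    refine h ⟨k, ?_⟩
    field_simp at hk
    rw [mul_comm]
    have : (q : ℂ) = k * T := by
      refine mul_left_cancel₀ Complex.two_pi_I_ne_zero ?_
      linear_combination (2 * Real.pi * Complex.I) * hk
    exact_mod_cast this
  rw [geom_sum_eq h1, ← Complex.exp_nat_mul,
    show (T : ℂ) * (2 * Real.pi * Complex.I * q / T) = q * (2 * Real.pi * Complex.I) by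
      field_simp, Complex.exp_int_mul_two_pi_mul_I]
  simp

lemma sum_exp_neg_eq_ramanujanSum (m q : ℕ) :
    ∑ b ∈ (Finset.Icc 1 m).filter (fun b => Nat.gcd b m = 1),
      Complex.exp (-(2 * Real.pi * Complex.I * b * q / m)) = ramanujanSum m q := by
  unfold ramanujanSum
  rcases Nat.lt_or_ge 1 m with hm | hm
  · have key : ∀ b ∈ (Finset.Icc 1 m).filter (fun b => Nat.gcd b m = 1),
        b < m ∧ m - b ∈ (Finset.Icc 1 m).filter (fun b => Nat.gcd b m = 1) := by
      intro b hb
      simp only [Finset.mem_filter, Finset.mem_Icc] at hb ⊢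
      have hbm : b ≠ m := by
        rintro rfl
        rw [Nat.gcd_self] at hb
        omega
      refine ⟨by omega, by omega, ?_⟩
      rw [Nat.gcd_comm, Nat.gcd_self_sub_right (by omega), Nat.gcd_comm]
      exact hb.2
    refine Finset.sum_bij' (fun b _ => m - b) (fun b _ => m - b) (fun b hb => (key b hb).2)
      (fun b hb => (key b hb).2) (fun b hb => Nat.sub_sub_self (key b hb).1.le)
      (fun b hb => Nat.sub_sub_self (key b hb).1.le) fun b hb => ?_
    rw [Complex.exp_eq_exp_iff_exists_int]
    refine ⟨-q, ?_⟩
    have hm0 : (m : ℂ) ≠ 0 := by exact_mod_cast (by omega : m ≠ 0)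
    rw [Nat.cast_sub (key b hb).1.le]
    push_cast
    field_simp
    ring
  · refine Finset.sum_congr rfl fun b hb => ?_
    simp only [Finset.mem_filter, Finset.mem_Icc] at hb
    obtain rfl : m = 1 := by omega
    obtain rfl : b = 1 := by omega
    rw [Complex.exp_eq_exp_iff_exists_int]
    refine ⟨-2 * q, ?_⟩
    push_cast
    ring

lemma exp_two_pi_mul_div_four (k : ℕ) :
    Complex.exp (2 * Real.pi * Complex.I * k / 4) = Complex.I ^ k := by
  rw [show 2 * (Real.pi : ℂ) * Complex.I * k / 4 = k * (Real.pi / 2 * Complex.I) by ring,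
    Complex.exp_nat_mul, Complex.exp_pi_div_two_mul_I]

lemma sineSum_eq_sub (m s q : ℕ) :
    sineSum (2 ^ (s + 2) * m) q = Complex.I *
      (∑ a ∈ Gsetr (2 ^ (s + 2) * m) 1 1,
          Complex.exp (2 * Real.pi * Complex.I * a * (q : ℤ) / (2 ^ (s + 2) * m : ℕ)) -
        ∑ a ∈ Gsetr (2 ^ (s + 2) * m) 1 1,
          Complex.exp (2 * Real.pi * Complex.I * a * (-q : ℤ) / (2 ^ (s + 2) * m : ℕ))) := by
  rw [sineSum, Finset.sum_sub_distrib]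
  simp only [Int.cast_neg, Int.cast_natCast, mul_neg, neg_div]

lemma sineSum_eq_zero_of_not_dvd {m s q : ℕ} (hm : Odd m) (h : ¬ 2 ^ s ∣ q) :
    sineSum (2 ^ (s + 2) * m) q = 0 := by
  have h1 : ¬ ((2 ^ s : ℕ) : ℤ) ∣ (q : ℤ) := by rwa [Int.natCast_dvd_natCast]
  have h2 : ¬ ((2 ^ s : ℕ) : ℤ) ∣ (-q : ℤ) := by rwa [dvd_neg]
  have hT : 0 < 2 ^ s := by positivity
  have g1 := geom_sum_exp_eq_zero hT h1
  have g2 := geom_sum_exp_eq_zero hT h2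
  rw [Nat.cast_pow, Nat.cast_ofNat] at g1 g2
  rw [sineSum_eq_sub, sum_exp_Gsetr_one_one hm, sum_exp_Gsetr_one_one hm, g1, g2]
  simp

lemma sineSum_two_pow_mul_s4 {m : ℕ} (s r : ℕ) (hm : Odd m) :
    sineSum (2 ^ (s + 2) * m) (2 ^ s * r) =
      2 ^ s * Complex.I * (Complex.I ^ (m * r) - (-Complex.I) ^ (m * r)) * ramanujanSum m r := by
  have hm0 : (m : ℂ) ≠ 0 := by exact_mod_cast hm.pos.ne'
  have hgeom : ∀ z : ℤ, ∑ j ∈ Finset.range (2 ^ s),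
      Complex.exp (2 * Real.pi * Complex.I * ((2 ^ s * z : ℤ) : ℂ) / 2 ^ s) ^ j = 2 ^ s := by
    intro z
    rw [show 2 * (Real.pi : ℂ) * Complex.I * ((2 ^ s * z : ℤ) : ℂ) / 2 ^ s =
      z * (2 * Real.pi * Complex.I) by push_cast; field_simp, Complex.exp_int_mul_two_pi_mul_I]
    simp
  have hpos := sum_exp_Gsetr_one_one (s := s) hm (2 ^ s * (r : ℤ))
  have hneg := sum_exp_Gsetr_one_one (s := s) hm (2 ^ s * (-r : ℤ))
  rw [hgeom] at hpos hneg
  rw [sineSum_eq_sub, show ((2 ^ s * r : ℕ) : ℤ) = 2 ^ s * (r : ℤ) by push_cast; rfl,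
    ← mul_neg, hpos, hneg]
  have e1 : ∑ b ∈ (Finset.Icc 1 m).filter (fun b => Nat.gcd b m = 1),
      Complex.exp (2 * Real.pi * Complex.I * (4 * b + m ^ 2) * ((2 ^ s * (r : ℤ) : ℤ) : ℂ) /
        (2 ^ (s + 2) * m : ℕ)) = Complex.I ^ (m * r) * ramanujanSum m r := by
    rw [ramanujanSum, Finset.mul_sum]
    refine Finset.sum_congr rfl fun b _ => ?_
    rw [← exp_two_pi_mul_div_four, ← Complex.exp_add]
    congr 1
    push_cast
    field_simp
    ring
  have e2 : ∑ b ∈ (Finset.Icc 1 m).filter (fun b => Nat.gcd b m = 1),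
      Complex.exp (2 * Real.pi * Complex.I * (4 * b + m ^ 2) * ((2 ^ s * (-r : ℤ) : ℤ) : ℂ) /
        (2 ^ (s + 2) * m : ℕ)) = (-Complex.I) ^ (m * r) * ramanujanSum m r := by
    rw [← sum_exp_neg_eq_ramanujanSum, Finset.mul_sum]
    refine Finset.sum_congr rfl fun b _ => ?_
    rw [← Complex.inv_I, inv_pow, ← exp_two_pi_mul_div_four, ← Complex.exp_neg, ← Complex.exp_add]
    congr 1
    push_cast
    field_simp
    ring
  rw [e1, e2]
  ring

lemma I_mul_I_pow_mul_of_odd {m r : ℕ} (hm : Odd m) (hr : Odd r) :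
    Complex.I * Complex.I ^ (m * r) = (-1) ^ ((m - 1) / 2) * (-1) ^ ((r + 1) / 2) := by
  obtain ⟨k, rfl⟩ := hm
  obtain ⟨l, rfl⟩ := hr
  rw [show (2 * k + 1 - 1) / 2 = k by omega, show (2 * l + 1 + 1) / 2 = l + 1 by omega,
    ← pow_succ', show (2 * k + 1) * (2 * l + 1) + 1 = 2 * (2 * (k * l) + k + (l + 1)) by ring,
    pow_mul, Complex.I_sq, pow_add, pow_add, pow_mul]
  simp

theorem sineSum_formula (m t : ℕ) (hm : Odd m) (hm0 : 0 < m) (ht : 2 ≤ t)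
    (q : ℕ) (hq : 0 < q) :
    (∀ q' : ℕ, Odd q' → q = 2 ^ (t - 2) * q' →
      sineSum (2 ^ t * m) q =
        (-1 : ℂ) ^ ((m - 1) / 2) * (-1 : ℂ) ^ ((q' + 1) / 2) * 2 ^ (t - 1) *
          ramanujanSum m q') ∧
    ((¬ 2 ^ (t - 2) ∣ q ∨ Even (q / 2 ^ (t - 2))) → sineSum (2 ^ t * m) q = 0) := by
  obtain ⟨s, rfl⟩ : ∃ s, t = s + 2 := ⟨t - 2, by omega⟩
  rw [Nat.add_sub_cancel, show s + 2 - 1 = s + 1 by omega]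
  refine ⟨?_, ?_⟩
  · rintro r hr rfl
    rw [sineSum_two_pow_mul_s4 s r hm, (hm.mul hr).neg_pow, ← I_mul_I_pow_mul_of_odd hm hr]
    ring
  · intro h
    by_cases hd : 2 ^ s ∣ q
    · obtain ⟨r, rfl⟩ := hd
      have hr : Even r := by
        simpa [Nat.mul_div_cancel_left r (show 0 < 2 ^ s by positivity)] using h
      rw [sineSum_two_pow_mul_s4 s r hm, (hr.mul_left m).neg_pow]
      ring
    · exact sineSum_eq_zero_of_not_dvd hm hd

end
end
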